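/- arXiv:1201.0936 — 2 statements merged into one kernel-verified Lean document; each statement's English description precedes it below -/
import Mathlib

section
/- For every integer n ≥ 4, there do not exist elements g, h ∈ ℂ(x,y,z) such that the subfield of ℂ(x,y,z) generated over ℂ by x^{n−1} + x y² + z², g, and h equals ℂ(x,y,z). That is, the field extension ℂ(x,y,z)/ℂ(d_n) with d_n = x^{n−1} + x y² + z² is not rational. -/
open MvPolynomial

noncomputable section

/-- The field ℂ(x,y,z): fraction field of the polynomial ring in 3 variables. -/
abbrev Fxyz : Type := FractionRing (MvPolynomial (Fin 3) ℂ)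

/-- The images of the variables x, y, z in ℂ(x,y,z). -/
def Vx : Fxyz := algebraMap (MvPolynomial (Fin 3) ℂ) Fxyz (X 0)
def Vy : Fxyz := algebraMap (MvPolynomial (Fin 3) ℂ) Fxyz (X 1)
def Vz : Fxyz := algebraMap (MvPolynomial (Fin 3) ℂ) Fxyz (X 2)

open scoped Polynomial

theorem exists_not_dvd_of_mul_eq_sq_mul {R : Type*} [CommRing R] [IsDomain R] [WfDvdMonoid R]
    {p α β u c : R} (hp : Prime p) (hα : ¬ p ∣ α) (hu : ¬ p ∣ u) (hc : ¬ p ∣ c)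
    {W Z Y : R} (hW : W ≠ 0) (h : u * (α * Z ^ 2 + β * Y ^ 2) = W ^ 2 * (p * c)) :
    ∃ Z' Y' : R, ¬ p ∣ Y' ∧ p ∣ α * Z' ^ 2 + β * Y' ^ 2 := by
  induction W using WellFounded.induction (wellFounded_dvdNotUnit (α := R)) generalizing Z Y with
  | _ W ih =>
    have hdvd : p ∣ α * Z ^ 2 + β * Y ^ 2 :=
      (hp.dvd_or_dvd (h ▸ Dvd.intro_left (W ^ 2 * c) (by ring))).resolve_left hu
    by_cases hY : p ∣ Y
    · obtain ⟨Y₁, rfl⟩ := hY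
      have hZ : p ∣ Z := by
        have : p ∣ α * Z ^ 2 := by
          rw [← dvd_add_left (c := β * (p * Y₁) ^ 2) ⟨β * p * Y₁ ^ 2, by ring⟩]
          exact hdvd
        exact hp.dvd_of_dvd_pow ((hp.dvd_or_dvd this).resolve_left hα)
      obtain ⟨Z₁, rfl⟩ := hZ
      have hWp : p ∣ W := by
        have : p * (u * (α * Z₁ ^ 2 + β * Y₁ ^ 2)) = W ^ 2 * c :=
          mul_left_cancel₀ hp.ne_zero (by linear_combination h)
        exact hp.dvd_of_dvd_pow ((hp.dvd_or_dvd (this ▸ dvd_mul_right _ _)).resolve_right hc)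
      obtain ⟨W₁, rfl⟩ := hWp
      have hW₁ : W₁ ≠ 0 := right_ne_zero_of_mul hW
      refine ih W₁ ⟨hW₁, p, hp.not_isUnit, mul_comm _ _⟩ hW₁ (Z := Z₁) (Y := Y₁) ?_
      exact mul_left_cancel₀ (pow_ne_zero 2 hp.ne_zero) (by linear_combination h)
    · exact ⟨Z, Y, hY, hdvd⟩

theorem exists_eq_expand_add {A : Type*} [CommRing A] (f : A[X]) :
    ∃ P Q : A[X], f = Polynomial.expand A 2 P + Polynomial.X * Polynomial.expand A 2 Q := by
  induction f using Polynomial.induction_on' with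
  | add f g hf hg =>
    obtain ⟨P, Q, rfl⟩ := hf
    obtain ⟨P', Q', rfl⟩ := hg
    exact ⟨P + P', Q + Q', by simp only [map_add]; ring⟩
  | monomial n a =>
    obtain ⟨k, rfl | rfl⟩ := Nat.even_or_odd' n
    · exact ⟨Polynomial.monomial k a, 0, by simp [mul_comm]⟩
    · exact ⟨0, Polynomial.monomial k a, by simp [Polynomial.X_mul_monomial, mul_comm]⟩

theorem expand_add_mul_conj {A : Type*} [CommRing A] (P Q : A[X]) :
    (Polynomial.expand A 2 P + Polynomial.X * Polynomial.expand A 2 Q) *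
        (Polynomial.expand A 2 P - Polynomial.X * Polynomial.expand A 2 Q) =
      Polynomial.expand A 2 (P ^ 2 - Polynomial.X * Q ^ 2) := by
  simp only [map_sub, map_mul, map_pow, Polynomial.expand_X]
  ring

theorem expand_add_X_mul_injective {A : Type*} [CommRing A] {P Q P' Q' : A[X]}
    (h : Polynomial.expand A 2 P + Polynomial.X * Polynomial.expand A 2 Q =
      Polynomial.expand A 2 P' + Polynomial.X * Polynomial.expand A 2 Q') :
    P = P' ∧ Q = Q' := by
  constructor
  · ext n
    have := congrArg (Polynomial.coeff · (2 * n)) h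
    rcases n with _ | n
    · simpa [Polynomial.coeff_expand] using this
    · simp only [Polynomial.coeff_add, mul_comm 2 (n + 1),
        Polynomial.coeff_expand_mul two_pos] at this
      rw [show (n + 1) * 2 = (2 * n + 1) + 1 by ring, Polynomial.coeff_X_mul,
        Polynomial.coeff_X_mul, Polynomial.coeff_expand two_pos,
        Polynomial.coeff_expand two_pos, if_neg (by omega), if_neg (by omega)] at this
      simpa using this
  · ext n
    have := congrArg (Polynomial.coeff · (2 * n + 1)) h
    simp only [Polynomial.coeff_add, Polynomial.coeff_X_mul, mul_comm 2 n,
      Polynomial.coeff_expand_mul two_pos] at this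
    rw [Polynomial.coeff_expand two_pos, Polynomial.coeff_expand two_pos,
      if_neg (by omega), if_neg (by omega)] at this
    simpa using this

theorem Prime.associated_sq_sub_X_mul_sq {A : Type*} [CommRing A] [IsDomain A]
    [UniqueFactorizationMonoid A] {p G H : A[X]} (hp : Prime p) (hH : ¬ p ∣ H)
    (h : p ∣ G ^ 2 - Polynomial.X * H ^ 2) :
    ∃ P Q : A[X], Associated p (P ^ 2 - Polynomial.X * Q ^ 2) := by
  have hinj : Function.Injective (Polynomial.expand A 2) := Polynomial.expand_injective two_pos
  have key : ∀ H' : A[X], ¬ p ∣ H' →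
      ¬ Polynomial.expand A 2 p ∣ Polynomial.expand A 2 G + Polynomial.X * Polynomial.expand A 2 H' := by
    rintro H' hH' ⟨c, hc⟩
    obtain ⟨P, Q, rfl⟩ := exists_eq_expand_add c
    refine hH' ⟨Q, (expand_add_X_mul_injective (P := G) (P' := p * P) ?_).2⟩
    rw [hc, map_mul, map_mul]
    ring
  have hnp : ¬ Prime (Polynomial.expand A 2 p) := by
    intro hpp
    have : Polynomial.expand A 2 p ∣
        (Polynomial.expand A 2 G + Polynomial.X * Polynomial.expand A 2 H) *
        (Polynomial.expand A 2 G - Polynomial.X * Polynomial.expand A 2 H) := by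
      rw [expand_add_mul_conj]
      obtain ⟨c, hc⟩ := h
      exact ⟨Polynomial.expand A 2 c, by rw [hc, map_mul]⟩
    rcases hpp.dvd_or_dvd this with h1 | h1
    · exact key H hH h1
    · refine key (-H) (by simpa using hH) ?_
      simpa [sub_eq_add_neg] using h1
  have hnu : ¬ IsUnit (Polynomial.expand A 2 p) := by
    intro hu
    exact key H hH hu.dvd
  obtain ⟨π, hπ, ρ, hρ⟩ := WfDvdMonoid.exists_irreducible_factor hnu
    (by simpa [Polynomial.expand_eq_zero] using hp.ne_zero)
  obtain ⟨P, Q, hPQ⟩ := exists_eq_expand_add π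
  obtain ⟨P', Q', hPQ'⟩ := exists_eq_expand_add ρ
  refine ⟨P, Q, ?_⟩
  have hconj : Polynomial.expand A 2 p =
      (Polynomial.expand A 2 P - Polynomial.X * Polynomial.expand A 2 Q) *
      (Polynomial.expand A 2 P' - Polynomial.X * Polynomial.expand A 2 Q') := by
    have h1 : Polynomial.expand A 2 p + Polynomial.X * Polynomial.expand A 2 0 =
        Polynomial.expand A 2 (P * P' + Polynomial.X * Q * Q') +
          Polynomial.X * Polynomial.expand A 2 (P * Q' + Q * P') := by
      simp only [hρ, hPQ, hPQ', map_add, map_mul, Polynomial.expand_X, map_zero]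
      ring
    obtain ⟨h2, h3⟩ := expand_add_X_mul_injective h1
    have h4 := congrArg (Polynomial.expand A 2) h2
    have h5 := congrArg (Polynomial.expand A 2) h3
    simp only [map_add, map_mul, Polynomial.expand_X, map_zero] at h4 h5
    linear_combination h4 - Polynomial.X * h5
  have hmul : p ^ 2 = (P ^ 2 - Polynomial.X * Q ^ 2) * (P' ^ 2 - Polynomial.X * Q' ^ 2) := by
    apply hinj
    rw [map_mul, ← expand_add_mul_conj, ← expand_add_mul_conj, map_pow, sq, ← hPQ, ← hPQ']
    nth_rewrite 2 [hconj]
    rw [hρ]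
    ring
  have hunit : ∀ {P Q : A[X]}, IsUnit (P ^ 2 - Polynomial.X * Q ^ 2) →
      IsUnit (Polynomial.expand A 2 P + Polynomial.X * Polynomial.expand A 2 Q) := by
    intro P Q hu
    have := hu.map (Polynomial.expand A 2)
    rw [← expand_add_mul_conj] at this
    exact isUnit_of_mul_isUnit_left this
  obtain ⟨i, hi, hassoc⟩ := (dvd_prime_pow hp 2).1 ⟨_, hmul⟩
  interval_cases i
  · exact absurd (hPQ ▸ hunit ((associated_one_iff_isUnit).1 (by simpa using hassoc))) hπ.not_isUnit
  · simpa using hassoc.symm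
  · exfalso
    obtain ⟨w, hw⟩ := hassoc
    have hw' : P' ^ 2 - Polynomial.X * Q' ^ 2 = (w : A[X]) :=
      mul_left_cancel₀ (left_ne_zero_of_mul (hmul ▸ pow_ne_zero 2 hp.ne_zero)) (hmul.symm.trans hw.symm)
    have hu : IsUnit ρ := hPQ' ▸ hunit (hw' ▸ w.isUnit)
    apply hnp
    rw [hρ]
    exact ((associated_mul_unit_right π ρ hu).prime_iff).1 (hπ.prime)

theorem exists_eq_sq_mul_squarefree {R : Type*} [CommRing R] [IsDomain R]
    [UniqueFactorizationMonoid R] {m : R} (hm : m ≠ 0) :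
    ∃ a b : R, m = a ^ 2 * b ∧ Squarefree b := by
  induction m using UniqueFactorizationMonoid.induction_on_prime with
  | h₁ => exact absurd rfl hm
  | h₂ u hu => exact ⟨1, u, by simp, hu.squarefree⟩
  | h₃ m p hm₀ hp ih =>
    obtain ⟨a, b, rfl, hb⟩ := ih hm₀
    by_cases hpb : p ∣ b
    · obtain ⟨b, rfl⟩ := hpb
      exact ⟨a * p, b, by ring, hb.squarefree_of_dvd (dvd_mul_left _ _)⟩
    · refine ⟨a, p * b, by ring, ?_⟩
      rw [squarefree_mul_iff]
      exact ⟨(hp.irreducible.isRelPrime_iff_not_dvd).2 hpb, hp.irreducible.squarefree, hb⟩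

/-- Norm forms of the extension `A(√X) / A(X)`. -/
def IsNormForm {A : Type*} [CommRing A] (m : A[X]) : Prop :=
  ∃ P Q : A[X], m = P ^ 2 - Polynomial.X * Q ^ 2

theorem IsNormForm.mul {A : Type*} [CommRing A] {m m' : A[X]} (h : IsNormForm m)
    (h' : IsNormForm m') : IsNormForm (m * m') := by
  obtain ⟨P, Q, rfl⟩ := h
  obtain ⟨P', Q', rfl⟩ := h'
  exact ⟨P * P' + Polynomial.X * Q * Q', P * Q' + P' * Q, by ring⟩

theorem IsSquare.isNormForm {A : Type*} [CommRing A] {m : A[X]} (h : IsSquare m) :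
    IsNormForm m := by
  obtain ⟨P, rfl⟩ := h
  exact ⟨P, 0, by ring⟩

theorem IsNormForm.of_prime_dvd {A : Type*} [CommRing A] [IsDomain A]
    [UniqueFactorizationMonoid A] (hA : ∀ u : A[X], IsUnit u → IsSquare u) {m : A[X]}
    (hm : m ≠ 0) (h : ∀ p, Prime p → p ∣ m → ∃ q, IsNormForm q ∧ Associated p q) :
    IsNormForm m := by
  induction m using UniqueFactorizationMonoid.induction_on_prime with
  | h₁ => exact absurd rfl hm
  | h₂ u hu => exact (hA u hu).isNormForm
  | h₃ m p hm₀ hp ih =>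
    refine IsNormForm.mul ?_ (ih hm₀ fun q hq hqm => h q hq (hqm.mul_left _))
    obtain ⟨q, hq, u, hu⟩ := h p hp (dvd_mul_right _ _)
    have : p = q * (u⁻¹ : (A[X])ˣ) := by rw [← hu, Units.mul_inv_cancel_right]
    rw [this]
    exact hq.mul (hA _ (Units.isUnit _)).isNormForm

/-- If `z² + x y² = s ^ N - x ^ N` with `x = ξ / δ` in lowest terms, then at every prime not dividing
`s` where `x - E s` has odd valuation, `s` is a square in the residue field. -/
theorem exists_dvd_sq_sub_mul_sq {R : Type*} [CommRing R] [IsDomain R] [WfDvdMonoid R] {N : ℕ}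
    {s E H p ξ δ W Y Z a b : R} (hN : IsUnit (N : R)) (hEN : E ^ N = 1) (hEu : IsUnit E)
    (hHu : IsUnit H) (hH2 : H ^ 2 = -E) (hrel : IsRelPrime ξ δ) (hW : W ≠ 0) (ha0 : a ≠ 0)
    (hab : ξ - E * s * δ = a ^ 2 * b) (hb : Squarefree b) (hp : Prime p) (hpb : p ∣ b)
    (hps : ¬ p ∣ s)
    (h : δ ^ (N - 1) * (δ * Z ^ 2 + ξ * Y ^ 2) = W ^ 2 * ((s * δ) ^ N - ξ ^ N)) :
    ∃ G H' : R, ¬ p ∣ H' ∧ p ∣ G ^ 2 - s * H' ^ 2 := by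
  have hpξ : p ∣ ξ - E * s * δ := hab ▸ hpb.mul_left _
  have hpδ : ¬ p ∣ δ := fun hd => hp.not_isUnit <|
    hrel ((dvd_sub_left (hd.mul_left _)).1 hpξ) hd
  have hpu : ∀ {v : R}, IsUnit v → ¬ p ∣ v := fun hv hd =>
    hp.not_isUnit (isUnit_of_dvd_unit hd hv)
  have hpEsδ : ¬ p ∣ E * s * δ := fun hd => by
    rcases hp.dvd_or_dvd hd with hd | hd
    · rcases hp.dvd_or_dvd hd with hd | hd
      · exact hpu hEu hd
      · exact hps hd
    · exact hpδ hd
  obtain ⟨b', rfl⟩ := hpb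
  have hpb' : ¬ p ∣ b' := fun ⟨c, hc⟩ => hp.not_isUnit (hb p ⟨c, by rw [hc]; ring⟩)
  set Ψ := ∑ i ∈ Finset.range N, ξ ^ i * (E * s * δ) ^ (N - 1 - i) with hΨ
  have hpΨ : ¬ p ∣ Ψ := by
    rw [hΨ, dvd_geom_sum₂_iff_of_dvd_sub hpξ]
    intro hd
    rcases hp.dvd_or_dvd hd with hd | hd
    · exact hpu hN hd
    · exact hpEsδ (hp.dvd_of_dvd_pow hd)
  have hfac : Ψ * (ξ - E * s * δ) = ξ ^ N - (s * δ) ^ N := by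
    rw [hΨ, geom_sum₂_mul, mul_assoc, mul_pow E, hEN, one_mul]
  obtain ⟨Z', Y', hY', hd⟩ := exists_not_dvd_of_mul_eq_sq_mul (u := δ ^ (N - 1)) (α := δ) (β := ξ)
    (c := -(b' * Ψ)) hp hpδ (fun hd => hpδ (hp.dvd_of_dvd_pow hd))
    (by rw [dvd_neg]; exact fun hd => (hp.dvd_or_dvd hd).elim hpb' hpΨ)
    (mul_ne_zero hW ha0) (Z := Z) (Y := Y) (by
      rw [hab] at hfac
      linear_combination h + W ^ 2 * hfac)
  refine ⟨Z', H * Y', fun hd => (hp.dvd_or_dvd hd).elim (hpu hHu) hY', ?_⟩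
  have hd' : p ∣ δ * (Z' ^ 2 - s * (H * Y') ^ 2) := by
    have : δ * (Z' ^ 2 - s * (H * Y') ^ 2) =
        (δ * Z' ^ 2 + ξ * Y' ^ 2) - (ξ - E * s * δ) * Y' ^ 2 := by
      linear_combination -δ * s * Y' ^ 2 * hH2
    rw [this]
    exact dvd_sub hd (hpξ.mul_right _)
  exact (hp.dvd_or_dvd hd').resolve_left hpδ

/-- Purity: on the conic bundle `z² + x y² = s ^ N - x ^ N`, where `s` is the polynomial variable
and `x = ξ / δ`, the function `δ (x - E s)` is a norm from the extension by `√s`. -/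
theorem isNormForm_sub_mul {A : Type*} [CommRing A] [IsDomain A] [UniqueFactorizationMonoid A]
    (hA : ∀ u : A[X], IsUnit u → IsSquare u) {N : ℕ} (hN : IsUnit (N : A[X])) {E : A[X]}
    (hEN : E ^ N = 1) {ξ δ W Y Z : A[X]} (hrel : IsRelPrime ξ δ) (hW : W ≠ 0)
    (hne : ξ - E * Polynomial.X * δ ≠ 0)
    (h : δ ^ (N - 1) * (δ * Z ^ 2 + ξ * Y ^ 2) = W ^ 2 * ((Polynomial.X * δ) ^ N - ξ ^ N)) :
    IsNormForm (ξ - E * Polynomial.X * δ) := by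
  have hEu : IsUnit E := IsUnit.of_pow_eq_one hEN fun h0 => by simp [h0] at hN
  obtain ⟨H, hH⟩ := hA (-E) hEu.neg
  have hHu : IsUnit H := isUnit_of_mul_isUnit_left (hH ▸ hEu.neg)
  obtain ⟨a, b, hab, hb⟩ := exists_eq_sq_mul_squarefree hne
  have hab0 := hab ▸ hne
  have ha0 : a ≠ 0 := fun h0 => hab0 (by simp [h0])
  rw [hab]
  refine IsNormForm.mul (IsSquare.isNormForm ⟨a, sq a⟩) ?_
  refine IsNormForm.of_prime_dvd hA (right_ne_zero_of_mul hab0) fun p hp hpb => ?_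
  by_cases hpX : p ∣ Polynomial.X
  · exact ⟨-Polynomial.X, ⟨0, 1, by ring⟩,
      (hp.associated_of_dvd Polynomial.prime_X hpX).neg_right⟩
  obtain ⟨G, H', hH', hd⟩ := exists_dvd_sq_sub_mul_sq hN hEN hEu hHu (by rw [hH, sq]) hrel hW ha0
    hab hb hp hpb hpX h
  obtain ⟨P, Q, hPQ⟩ := hp.associated_sq_sub_X_mul_sq hH' hd
  exact ⟨_, ⟨P, Q, rfl⟩, hPQ⟩

theorem isSquare_of_isUnit {σ : Type*} {u : (MvPolynomial σ ℂ)[X]} (hu : IsUnit u) :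
    IsSquare u := by
  obtain ⟨r, hr, rfl⟩ := Polynomial.isUnit_iff.1 hu
  obtain ⟨c, -, rfl⟩ := MvPolynomial.isUnit_iff_eq_C_of_isReduced.1 hr
  obtain ⟨d, rfl⟩ := IsAlgClosed.exists_pow_nat_eq c two_pos
  exact ⟨Polynomial.C (C d), by simp [sq]⟩

theorem not_isSquare_algebraMap_ratFunc {k : Type*} [Field k] {r : k[X]} {e : k}
    (hr : r.eval e = 0) (hr' : r.derivative.eval e ≠ 0) :
    ¬ IsSquare (algebraMap k[X] (RatFunc k) r) := by
  rintro ⟨t, ht⟩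
  have hr0 : r ≠ 0 := by
    rintro rfl
    simp at hr'
  have hd : t.denom ≠ 0 := t.denom_ne_zero
  have heq : r * t.denom ^ 2 = t.num ^ 2 := by
    apply RatFunc.algebraMap_injective k
    have hd' : algebraMap k[X] (RatFunc k) t.denom ≠ 0 := RatFunc.algebraMap_ne_zero hd
    have := t.num_div_denom
    rw [div_eq_iff hd'] at this
    rw [map_mul, map_pow, map_pow, this, ht]
    ring
  have h1 : r.rootMultiplicity e = 1 := by
    have := (Polynomial.rootMultiplicity_pos hr0).2 hr
    have := (Polynomial.one_lt_rootMultiplicity_iff_isRoot hr0 (t := e)).not.2 fun h => hr' h.2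
    omega
  have hn : t.num ≠ 0 := by
    intro hn
    rw [hn] at heq
    simp [hr0, hd] at heq
  have := congrArg (Polynomial.rootMultiplicity e) heq
  rw [Polynomial.rootMultiplicity_mul (mul_ne_zero hr0 (pow_ne_zero 2 hd)), sq, sq,
    Polynomial.rootMultiplicity_mul (mul_ne_zero hd hd),
    Polynomial.rootMultiplicity_mul (mul_ne_zero hn hn)] at this
  omega

theorem not_exists_eq_sq_add_mul_sq {F : Type*} [Field F] (h2 : (2 : F) ≠ 0) {a c g : F}
    (ha : a ≠ 0) (hg : ¬ IsSquare g) (hc : ¬ IsSquare c) (hcg : ¬ IsSquare (c * g)) :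
    ¬ ∃ A B : RatFunc F,
      RatFunc.C c = A ^ 2 + RatFunc.C a * (RatFunc.X ^ 2 - RatFunc.C g) * B ^ 2 := by
  rintro ⟨A, B, hAB⟩
  set q : F[X] := Polynomial.X ^ 2 - Polynomial.C g with hq
  have hmon : q.Monic := Polynomial.monic_X_pow_sub_C g two_ne_zero
  have hdeg : q.natDegree = 2 := Polynomial.natDegree_X_pow_sub_C
  have hqp : Prime q := (X_pow_sub_C_irreducible_of_prime Nat.prime_two
    fun b hb => hg ⟨b, by rw [← hb, sq]⟩).prime
  have hdA := A.denom_ne_zero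
  have hdB := B.denom_ne_zero
  have heq : (A.num * B.denom) ^ 2 + -Polynomial.C c * (A.denom * B.denom) ^ 2 =
      (B.num * A.denom) ^ 2 * (q * -Polynomial.C a) := by
    apply RatFunc.algebraMap_injective F
    have hdA' : algebraMap F[X] (RatFunc F) A.denom ≠ 0 := RatFunc.algebraMap_ne_zero hdA
    have hdB' : algebraMap F[X] (RatFunc F) B.denom ≠ 0 := RatFunc.algebraMap_ne_zero hdB
    have hA := A.num_div_denom
    have hB := B.num_div_denom
    rw [div_eq_iff hdA'] at hA
    rw [div_eq_iff hdB'] at hB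
    simp only [hq, map_add, map_mul, map_pow, map_neg, map_sub, RatFunc.algebraMap_C,
      RatFunc.algebraMap_X, hA, hB, hAB]
    ring
  have hBn : B.num * A.denom ≠ 0 := by
    intro h0
    rw [h0] at heq
    have h1 : (A.num * B.denom) ^ 2 = Polynomial.C c * (A.denom * B.denom) ^ 2 := by
      linear_combination heq
    have h3 := congrArg Polynomial.leadingCoeff h1
    rw [Polynomial.leadingCoeff_pow, Polynomial.leadingCoeff_mul (Polynomial.C c),
      Polynomial.leadingCoeff_C, Polynomial.leadingCoeff_pow] at h3
    have h4 : (A.denom * B.denom).leadingCoeff ≠ 0 :=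
      Polynomial.leadingCoeff_ne_zero.2 (mul_ne_zero hdA hdB)
    refine hc ⟨(A.num * B.denom).leadingCoeff / (A.denom * B.denom).leadingCoeff, ?_⟩
    field_simp
    exact h3.symm
  obtain ⟨Z, Y, hY, hd⟩ := exists_not_dvd_of_mul_eq_sq_mul (u := 1) (α := 1)
    (β := -Polynomial.C c) (c := -Polynomial.C a) (W := B.num * A.denom) (Z := A.num * B.denom)
    (Y := A.denom * B.denom) hqp hqp.not_dvd_one hqp.not_dvd_one
    (by
      rw [dvd_neg]
      exact fun hd => hqp.not_isUnit (isUnit_of_dvd_unit hd (Polynomial.isUnit_C.2 ha.isUnit)))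
    hBn (by rw [one_mul, one_mul]; exact heq)
  obtain ⟨i, j, hij⟩ := (hqp.irreducible.coprime_iff_not_dvd).2 hY
  set P := (Z * j) %ₘ q with hP
  have hPd : P.natDegree ≤ 1 := by
    have := Polynomial.natDegree_modByMonic_lt (Z * j) hmon hqp.ne_one
    rw [← hP] at this
    omega
  have hqP : q ∣ P ^ 2 - Polynomial.C c := by
    have hPZ : P = Z * j - q * ((Z * j) /ₘ q) := by
      rw [hP, Polynomial.modByMonic_eq_sub_mul_div]
    obtain ⟨d, hd⟩ := hd
    rw [hPZ]
    refine ⟨j ^ 2 * d - 2 * (Z * j) * ((Z * j) /ₘ q) + q * ((Z * j) /ₘ q) ^ 2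
      + Polynomial.C c * (-i) * (1 + Y * j), ?_⟩
    linear_combination j ^ 2 * hd + Polynomial.C c * (1 + Y * j) * hij
  obtain ⟨v, u, huv⟩ := Polynomial.exists_eq_X_add_C_of_natDegree_le_one hPd
  have hlin : q ∣ Polynomial.C (2 * u * v) * Polynomial.X + Polynomial.C (u ^ 2 + v ^ 2 * g - c) := by
    have : Polynomial.C (2 * u * v) * Polynomial.X + Polynomial.C (u ^ 2 + v ^ 2 * g - c) =
        (P ^ 2 - Polynomial.C c) - q * Polynomial.C v ^ 2 := by
      rw [huv, hq]
      simp only [map_mul, map_add, map_sub, map_pow, map_ofNat]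
      ring
    rw [this]
    exact dvd_sub hqP (dvd_mul_right _ _)
  have hzero := Polynomial.eq_zero_of_dvd_of_natDegree_lt hlin
    (lt_of_le_of_lt Polynomial.natDegree_linear_le (by omega))
  have hco : ∀ α β : F, Polynomial.C α * Polynomial.X + Polynomial.C β = 0 → α = 0 ∧ β = 0 :=
    fun α β h => ⟨by simpa [Polynomial.coeff_C] using congrArg (Polynomial.coeff · 1) h,
      by simpa using congrArg (Polynomial.coeff · 0) h⟩
  obtain ⟨h1, h0⟩ := hco _ _ hzero
  rcases mul_eq_zero.1 h1 with h1 | rfl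
  · obtain rfl : u = 0 := (mul_eq_zero.1 h1).resolve_left h2
    exact hcg ⟨v * g, by linear_combination -g * h0⟩
  · exact hc ⟨u, by linear_combination -h0⟩

open scoped IntermediateField.algebraAdjoinAdjoin in
theorem algebraicIndependent_of_adjoin_insert_eq_top {L : Type*} [Field L] [Algebra ℂ L] {m : ℕ}
    (htr : m ≤ Algebra.trdeg ℂ L) (v : Fin m → L) (s : L)
    (hs : IsIntegral (IntermediateField.adjoin ℂ (Set.range v)) s)
    (htop : IntermediateField.adjoin ℂ (insert s (Set.range v)) = ⊤) :
    AlgebraicIndependent ℂ v := by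
  have hK : Algebra.IsAlgebraic (IntermediateField.adjoin ℂ (Set.range v)) L := by
    have h1 := IntermediateField.isAlgebraic_adjoin_simple hs
    have h2 : IntermediateField.adjoin (IntermediateField.adjoin ℂ (Set.range v)) {s} = ⊤ := by
      rw [← IntermediateField.restrictScalars_eq_top_iff (K := ℂ),
        IntermediateField.adjoin_adjoin_left, Set.union_singleton, htop]
    rw [h2] at h1
    exact IntermediateField.topEquiv.isAlgebraic_iff.1 h1
  have : Algebra.IsAlgebraic (Algebra.adjoin ℂ (Set.range v)) L :=
    (IsFractionRing.comap_isAlgebraic_iff (K := IntermediateField.adjoin ℂ (Set.range v))).2 hK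
  exact (Algebra.IsAlgebraic.isTranscendenceBasis_of_lift_le_trdeg_of_finite ℂ v (by simpa using htr)).1

theorem trdeg_add_one_le_trdeg_ratFunc (k F : Type) [Field k] [Field F] [Algebra k F] :
    Algebra.trdeg k F + 1 ≤ Algebra.trdeg k (RatFunc F) := by
  rw [← trdeg_add_eq k F (A := RatFunc F)]
  gcongr
  rw [Cardinal.one_le_iff_pos]
  exact trdeg_pos _ _

theorem Matrix.range_vecCons_three {α : Type*} (a b c : α) : Set.range ![a, b, c] = {a, b, c} := by
  ext t
  simp [eq_comm]
  tauto

theorem RatFunc.intermediateField_eq_top {k F : Type*} [Field k] [Field F] [Algebra k F]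
    {S : IntermediateField k (RatFunc F)} (hC : ∀ c : F, RatFunc.C c ∈ S) (hX : RatFunc.X ∈ S) :
    S = ⊤ := by
  have hpol : ∀ p : F[X], algebraMap F[X] (RatFunc F) p ∈ S := by
    intro p
    induction p using Polynomial.induction_on' with
    | add p q hp hq =>
      rw [map_add]
      exact add_mem hp hq
    | monomial n c =>
      rw [← Polynomial.C_mul_X_pow_eq_monomial, map_mul, map_pow, RatFunc.algebraMap_C,
        RatFunc.algebraMap_X]
      exact mul_mem (hC c) (pow_mem hX n)
  refine eq_top_iff.2 fun f _ => ?_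
  rw [← f.num_div_denom]
  exact div_mem (hpol _) (hpol _)

/-- If `L` is a rational function field in the three variables `s, g, h`, every element of `L` is a
fraction of polynomials in `s` with coefficients in `ℂ[g, h]`. -/
theorem exists_injective_polynomial_hom {L : Type*} [Field L] [Algebra ℂ L]
    (htr : (3 : ℕ) ≤ Algebra.trdeg ℂ L) {s g h : L}
    (htop : IntermediateField.adjoin ℂ {s, g, h} = ⊤) :
    ∃ ψ : (MvPolynomial (Fin 2) ℂ)[X] →ₐ[ℂ] L, Function.Injective ψ ∧ ψ Polynomial.X = s ∧
      ∀ x : L, ∃ p q, q ≠ 0 ∧ x = ψ p / ψ q := by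
  have hrange := Matrix.range_vecCons_three s g h
  have hind : AlgebraicIndependent ℂ ![s, g, h] := by
    refine algebraicIndependent_of_adjoin_insert_eq_top htr _ s ?_ ?_
    · exact isIntegral_algebraMap (x := (⟨s, IntermediateField.subset_adjoin _ _ ⟨0, rfl⟩⟩ :
        IntermediateField.adjoin ℂ (Set.range ![s, g, h])))
    · rw [hrange, Set.insert_eq_of_mem (Set.mem_insert _ _), htop]
  refine ⟨(aeval ![s, g, h]).comp (finSuccEquiv ℂ 2).symm.toAlgHom,
    Function.Injective.comp (g := aeval ![s, g, h]) hind (finSuccEquiv ℂ 2).symm.injective,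
    ?_, fun x => ?_⟩
  · have : (finSuccEquiv ℂ 2).symm Polynomial.X = X 0 := by
      rw [AlgEquiv.symm_apply_eq, finSuccEquiv_X_zero]
    simp [this]
  · have hx : x ∈ IntermediateField.adjoin ℂ (Set.range ![s, g, h]) := by
      rw [hrange, htop]
      trivial
    obtain ⟨p, q, rfl⟩ := (IntermediateField.mem_adjoin_range_iff _ _ _).1 hx
    by_cases hq : q = 0
    · exact ⟨0, 1, one_ne_zero, by simp [hq]⟩
    · exact ⟨finSuccEquiv ℂ 2 p, finSuccEquiv ℂ 2 q, by simpa using hq, by simp⟩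

/-- If `ℂ(s, g, h)` carries a point `(x, y, z)` of the conic bundle `z² + x y² = s ^ N - x ^ N`, then
`(x / s - e₁) (x / s - e₂)` is a norm from the extension by `√s`. -/
theorem exists_eq_sq_sub_mul_sq_of_adjoin_eq_top {L : Type*} [Field L] [Algebra ℂ L]
    (htr : (3 : ℕ) ≤ Algebra.trdeg ℂ L) {N : ℕ} (hN : N ≠ 0) {s g h x y z : L}
    (hs : s ≠ 0) (heq : x ^ N + x * y ^ 2 + z ^ 2 = s ^ N)
    (htop : IntermediateField.adjoin ℂ {s, g, h} = ⊤) {e₁ e₂ : ℂ}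
    (he₁ : e₁ ^ N = 1) (he₂ : e₂ ^ N = 1) (hx₁ : x ≠ algebraMap ℂ L e₁ * s)
    (hx₂ : x ≠ algebraMap ℂ L e₂ * s) :
    ∃ A B : L, (x / s - algebraMap ℂ L e₁) * (x / s - algebraMap ℂ L e₂) = A ^ 2 - s * B ^ 2 := by
  obtain ⟨ψ, hψ, hψs, hfrac⟩ := exists_injective_polynomial_hom htr htop
  have hψ0 : ∀ {p}, p ≠ 0 → ψ p ≠ 0 := fun hp => (map_ne_zero_iff ψ hψ).2 hp
  obtain ⟨ξ, δ, hδ, hrel, hx⟩ : ∃ ξ δ, δ ≠ 0 ∧ IsRelPrime ξ δ ∧ x = ψ ξ / ψ δ := by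
    obtain ⟨p, q, hq, rfl⟩ := hfrac x
    obtain ⟨q', p', c, hrel, rfl, rfl⟩ := UniqueFactorizationMonoid.exists_reduced_factors q hq p
    have hc := left_ne_zero_of_mul hq
    refine ⟨p', q', right_ne_zero_of_mul hq, hrel.symm, ?_⟩
    rw [map_mul, map_mul, mul_div_mul_left _ _ (hψ0 hc)]
  obtain ⟨Y, W₁, hW₁, hy⟩ := hfrac y
  obtain ⟨Z, W₂, hW₂, hz⟩ := hfrac z
  have hδ' := hψ0 hδ
  have hW₁' := hψ0 hW₁
  have hW₂' := hψ0 hW₂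
  rw [eq_div_iff hδ'] at hx
  rw [eq_div_iff hW₁'] at hy
  rw [eq_div_iff hW₂'] at hz
  have hmain : δ ^ (N - 1) * (δ * (Z * W₁) ^ 2 + ξ * (Y * W₂) ^ 2) =
      (W₁ * W₂) ^ 2 * ((Polynomial.X * δ) ^ N - ξ ^ N) := by
    apply hψ
    have hpow : ψ δ ^ N = ψ δ ^ (N - 1) * ψ δ := by
      rw [← pow_succ, Nat.sub_add_cancel (Nat.pos_of_ne_zero hN)]
    simp only [map_mul, map_add, map_sub, map_pow, hψs, ← hx, ← hy, ← hz, mul_pow, ← heq]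
    rw [hpow]
    ring
  have hcast : IsUnit (N : (MvPolynomial (Fin 2) ℂ)[X]) := by
    rw [← map_natCast (algebraMap ℂ (MvPolynomial (Fin 2) ℂ)[X])]
    exact (IsUnit.mk0 (N : ℂ) (by exact_mod_cast hN)).map _
  have hnorm : ∀ {e : ℂ}, e ^ N = 1 → x ≠ algebraMap ℂ L e * s →
      ∃ P Q, ψ ξ - algebraMap ℂ L e * s * ψ δ = ψ P ^ 2 - s * ψ Q ^ 2 := by
    intro e he hxe
    have hψe : ψ (algebraMap ℂ (MvPolynomial (Fin 2) ℂ)[X] e) = algebraMap ℂ L e := ψ.commutes e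
    obtain ⟨P, Q, hPQ⟩ := isNormForm_sub_mul (fun _ => isSquare_of_isUnit) hcast
      (E := algebraMap ℂ (MvPolynomial (Fin 2) ℂ)[X] e) (by rw [← map_pow, he, map_one]) hrel
      (mul_ne_zero hW₁ hW₂) (fun h0 => hxe (by
        have := congrArg ψ h0
        rw [map_sub, map_mul, map_mul, map_zero, hψs, hψe, ← hx, ← sub_mul] at this
        exact sub_eq_zero.1 ((mul_eq_zero.1 this).resolve_right hδ'))) hmain
    refine ⟨P, Q, ?_⟩
    have := congrArg ψ hPQ
    simpa only [map_sub, map_mul, map_pow, hψs, hψe] using this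
  obtain ⟨P, Q, hPQ⟩ := hnorm he₁ hx₁
  obtain ⟨P', Q', hPQ'⟩ := hnorm he₂ hx₂
  refine ⟨(ψ P * ψ P' + s * ψ Q * ψ Q') / (s * ψ δ), (ψ P * ψ Q' + ψ P' * ψ Q) / (s * ψ δ), ?_⟩
  rw [← hx] at hPQ hPQ'
  have hprod : (x * ψ δ - algebraMap ℂ L e₁ * s * ψ δ) * (x * ψ δ - algebraMap ℂ L e₂ * s * ψ δ) =
      (ψ P * ψ P' + s * ψ Q * ψ Q') ^ 2 - s * (ψ P * ψ Q' + ψ P' * ψ Q) ^ 2 := by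
    rw [hPQ, hPQ']
    ring
  have hsδ : (s * ψ δ) ^ 2 ≠ 0 := pow_ne_zero 2 (mul_ne_zero hs hδ')
  rw [div_pow, div_pow, ← mul_div_assoc, ← sub_div, ← hprod, eq_div_iff hsδ]
  field_simp

/-- Generators of `ℂ(x, y, z)` over `ℂ(d)`, with `d = x ^ N + x y² + z²`, remain generators after
adjoining an `N`-th root `s` of `d`. -/
theorem exists_adjoin_eq_top_of_root {L : Type*} [Field L] [Algebra ℂ L]
    (htr : (3 : ℕ) ≤ Algebra.trdeg ℂ L) {N : ℕ} (hN : N ≠ 0) {s x y z : L}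
    (heq : x ^ N + x * y ^ 2 + z ^ 2 = s ^ N)
    (htop : IntermediateField.adjoin ℂ {s, x, y, z} = ⊤) {g h : Fxyz}
    (hgh : IntermediateField.adjoin ℂ {Vx ^ N + Vx * Vy ^ 2 + Vz ^ 2, g, h} = ⊤) :
    ∃ g' h' : L, IntermediateField.adjoin ℂ {s, g', h'} = ⊤ := by
  have hrange := Matrix.range_vecCons_three x y z
  have hind : AlgebraicIndependent ℂ ![x, y, z] := by
    refine algebraicIndependent_of_adjoin_insert_eq_top htr _ s ?_ (by rw [hrange, htop])
    have hmem : ∀ i, ![x, y, z] i ∈ IntermediateField.adjoin ℂ (Set.range ![x, y, z]) :=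
      fun i => IntermediateField.subset_adjoin _ _ ⟨i, rfl⟩
    have hd : s ^ N ∈ IntermediateField.adjoin ℂ (Set.range ![x, y, z]) := by
      rw [← heq]
      exact add_mem (add_mem (pow_mem (hmem 0) _) (mul_mem (hmem 0) (pow_mem (hmem 1) _)))
        (pow_mem (hmem 2) _)
    exact IsIntegral.of_pow (Nat.pos_of_ne_zero hN)
      (isIntegral_algebraMap (x := (⟨_, hd⟩ : IntermediateField.adjoin ℂ (Set.range ![x, y, z]))))
  let φ : Fxyz →ₐ[ℂ] L := IsFractionRing.liftAlgHom (g := aeval ![x, y, z]) hind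
  have hφ : ∀ i, φ (algebraMap (MvPolynomial (Fin 3) ℂ) Fxyz (X i)) = ![x, y, z] i := fun i => by
    rw [← aeval_X (R := ℂ) ![x, y, z] i]
    exact IsFractionRing.lift_algebraMap
      (g := (aeval ![x, y, z] : MvPolynomial (Fin 3) ℂ →ₐ[ℂ] L).toRingHom)
      hind (X i)
  have hφx : φ Vx = x := hφ 0
  have hφy : φ Vy = y := hφ 1
  have hφz : φ Vz = z := hφ 2
  refine ⟨φ g, φ h, ?_⟩
  set S := IntermediateField.adjoin ℂ {s, φ g, φ h}
  have hsS : s ∈ S := IntermediateField.subset_adjoin _ _ (by simp)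
  have hle : φ.fieldRange ≤ S := by
    rw [AlgHom.fieldRange_eq_map, ← hgh, IntermediateField.adjoin_map,
      IntermediateField.adjoin_le_iff]
    rintro _ ⟨f, rfl | rfl | rfl, rfl⟩
    · simp only [map_add, map_mul, map_pow, hφx, hφy, hφz, heq]
      exact pow_mem hsS N
    · exact IntermediateField.subset_adjoin _ _ (by simp)
    · exact IntermediateField.subset_adjoin _ _ (by simp)
  rw [eq_top_iff, ← htop, IntermediateField.adjoin_le_iff]
  rintro _ (rfl | rfl | rfl | rfl)
  · exact hsS
  · exact hφx ▸ hle ⟨Vx, rfl⟩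
  · exact hφy ▸ hle ⟨Vy, rfl⟩
  · exact hφz ▸ hle ⟨Vz, rfl⟩

theorem RatFunc.C_mem_of_comap_eq_top {k F : Type*} [Field k] [Field F] [Algebra k F]
    {S : IntermediateField k (RatFunc F)}
    (hS : S.comap (IsScalarTower.toAlgHom k F (RatFunc F)) = ⊤) (c : F) : RatFunc.C c ∈ S := by
  have : c ∈ S.comap (IsScalarTower.toAlgHom k F (RatFunc F)) := hS ▸ trivial
  exact this

theorem RatFunc.X_sq_sub_C_ne_zero {F : Type*} [Field F] (g : F) :
    (RatFunc.X ^ 2 - RatFunc.C g : RatFunc F) ≠ 0 := by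
  have h := (map_ne_zero_iff (algebraMap F[X] (RatFunc F)) (RatFunc.algebraMap_injective F)).2
    (Polynomial.X_pow_sub_C_ne_zero two_pos g)
  simpa only [map_sub, map_pow, RatFunc.algebraMap_X, RatFunc.algebraMap_C] using h

theorem not_isSquare_sq_mul {F : Type*} [Field F] {t u : F} (ht : t ≠ 0) (hu : ¬ IsSquare u) :
    ¬ IsSquare (t ^ 2 * u) := by
  rintro ⟨v, hv⟩
  refine hu ⟨v / t, ?_⟩
  field_simp
  linear_combination hv

/-- The three nonvanishing conditions for the residue along `b² = g`, where `g` equals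
`a ^ j * (1 - a ^ N)` up to squares. -/
theorem not_isSquare_ratFunc {k : Type*} [Field k] [CharZero k] {N j : ℕ} (hN : N ≠ 0)
    {e₁ e₂ e₃ : k} (h₁₂ : e₁ ≠ e₂) (h₁₃ : e₁ ≠ e₃) (h₂₃ : e₂ ≠ e₃) (h₃ : e₃ ^ N = 1)
    {t : RatFunc k} (ht : t ≠ 0) :
    ¬ IsSquare (t ^ 2 * (RatFunc.X ^ j * (1 - RatFunc.X ^ N))) ∧
    ¬ IsSquare ((RatFunc.X - RatFunc.C e₁) * (RatFunc.X - RatFunc.C e₂)) ∧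
    ¬ IsSquare ((RatFunc.X - RatFunc.C e₁) * (RatFunc.X - RatFunc.C e₂) *
      (t ^ 2 * (RatFunc.X ^ j * (1 - RatFunc.X ^ N)))) := by
  have he₃ : e₃ ≠ 0 := by
    rintro rfl
    simp [hN] at h₃
  have hd : (Polynomial.derivative (1 - Polynomial.X ^ N : k[X])).eval e₃ ≠ 0 := by
    simp [Polynomial.derivative_X_pow, hN, he₃]
  have h0 : (1 - Polynomial.X ^ N : k[X]).eval e₃ = 0 := by simp [h₃]
  refine ⟨not_isSquare_sq_mul ht ?_, ?_, ?_⟩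
  · have := not_isSquare_algebraMap_ratFunc (r := Polynomial.X ^ j * (1 - Polynomial.X ^ N))
      (e := e₃) (by rw [Polynomial.eval_mul, h0, mul_zero]) (by
        rw [Polynomial.derivative_mul, Polynomial.eval_add, Polynomial.eval_mul, Polynomial.eval_mul,
          h0, mul_zero, zero_add]
        exact mul_ne_zero (by simp [he₃]) hd)
    simpa using this
  · have := not_isSquare_algebraMap_ratFunc
      (r := (Polynomial.X - Polynomial.C e₁) * (Polynomial.X - Polynomial.C e₂))
      (e := e₁) (by simp) (by simpa [sub_eq_zero] using h₁₂)
    simpa using this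
  · have := not_isSquare_algebraMap_ratFunc
      (r := ((Polynomial.X - Polynomial.C e₁) * (Polynomial.X - Polynomial.C e₂) *
        Polynomial.X ^ j) * (1 - Polynomial.X ^ N))
      (e := e₃) (by rw [Polynomial.eval_mul, h0, mul_zero]) (by
        rw [Polynomial.derivative_mul, Polynomial.eval_add, Polynomial.eval_mul, Polynomial.eval_mul,
          h0, mul_zero, zero_add]
        exact mul_ne_zero (by simp [he₃, sub_eq_zero, h₁₃.symm, h₂₃.symm]) hd)
    rw [mul_left_comm]
    refine not_isSquare_sq_mul ht ?_
    simpa [mul_assoc] using this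

/-- The irrationality criterion: a parametrization over `F(b)` of the base change of
`d = x ^ N + x y² + z²` by an `N`-th root `s = -w² a (b² - g)` of `d`, with `x = a s`. -/
theorem adjoin_ne_top_of_parametrization {F : Type} [Field F] [CharZero F] [Algebra ℂ F]
    (htr : (2 : ℕ) ≤ Algebra.trdeg ℂ F) {w a g : F} (hw : w ≠ 0) (ha : a ≠ 0)
    (hF : ∀ S : IntermediateField ℂ F, w ∈ S → a ∈ S → S = ⊤)
    {N : ℕ} (hN : N ≠ 0) {e₁ e₂ : ℂ} (he₁ : e₁ ^ N = 1) (he₂ : e₂ ^ N = 1)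
    (hg : ¬ IsSquare g) (hc : ¬ IsSquare ((a - algebraMap ℂ F e₁) * (a - algebraMap ℂ F e₂)))
    (hcg : ¬ IsSquare ((a - algebraMap ℂ F e₁) * (a - algebraMap ℂ F e₂) * g))
    {s y z : RatFunc F}
    (hs : s = -RatFunc.C w ^ 2 * RatFunc.C a * (RatFunc.X ^ 2 - RatFunc.C g))
    (heq : (RatFunc.C a * s) ^ N + RatFunc.C a * s * y ^ 2 + z ^ 2 = s ^ N)
    (hgen : ∀ S : IntermediateField ℂ (RatFunc F), s ∈ S → RatFunc.C a ∈ S → y ∈ S → z ∈ S →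
      RatFunc.C w ∈ S ∧ RatFunc.X ∈ S) (g' h' : Fxyz) :
    IntermediateField.adjoin ℂ {Vx ^ N + Vx * Vy ^ 2 + Vz ^ 2, g', h'} ≠ ⊤ := by
  intro hgh
  have hs₀ : s ≠ 0 := by
    rw [hs]
    refine mul_ne_zero (mul_ne_zero (neg_ne_zero.2 (pow_ne_zero 2 ?_)) ?_)
      (RatFunc.X_sq_sub_C_ne_zero g)
    · exact (map_ne_zero _).2 hw
    · exact (map_ne_zero _).2 ha
  have htr' : (3 : ℕ) ≤ Algebra.trdeg ℂ (RatFunc F) := by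
    refine le_trans ?_ (trdeg_add_one_le_trdeg_ratFunc ℂ F)
    calc ((3 : ℕ) : Cardinal) = (2 : ℕ) + 1 := by norm_num
      _ ≤ Algebra.trdeg ℂ F + 1 := by gcongr
  have htop : IntermediateField.adjoin ℂ {s, RatFunc.C a * s, y, z} = ⊤ := by
    set S := IntermediateField.adjoin ℂ {s, RatFunc.C a * s, y, z}
    have hsub : {s, RatFunc.C a * s, y, z} ⊆ (S : Set (RatFunc F)) :=
      IntermediateField.subset_adjoin ℂ _
    have hsS : s ∈ S := hsub (by simp)
    have haS : RatFunc.C a ∈ S := by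
      have h1 : RatFunc.C a * s ∈ S := hsub (by simp)
      have := div_mem h1 hsS
      rwa [mul_div_cancel_right₀ _ hs₀] at this
    obtain ⟨hwS, hbS⟩ := hgen S hsS haS (hsub (by simp)) (hsub (by simp))
    exact RatFunc.intermediateField_eq_top (RatFunc.C_mem_of_comap_eq_top (hF _ hwS haS)) hbS
  obtain ⟨g'', h'', hgh'⟩ := exists_adjoin_eq_top_of_root htr' hN heq htop hgh
  have halg : ∀ e : ℂ, algebraMap ℂ (RatFunc F) e = RatFunc.C (algebraMap ℂ F e) := fun _ => rfl
  have hne : ∀ e : ℂ, a - algebraMap ℂ F e ≠ 0 →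
      RatFunc.C a * s ≠ algebraMap ℂ (RatFunc F) e * s := fun e h₀ h => by
    rw [halg] at h
    exact h₀ (sub_eq_zero.2 (RingHom.injective _ (mul_right_cancel₀ hs₀ h)))
  obtain ⟨A, B, hAB⟩ := exists_eq_sq_sub_mul_sq_of_adjoin_eq_top htr' hN hs₀ heq hgh' he₁ he₂
    (hne e₁ fun h₀ => hc (by rw [h₀, zero_mul]; exact IsSquare.zero))
    (hne e₂ fun h₀ => hc (by rw [h₀, mul_zero]; exact IsSquare.zero))
  rw [mul_div_cancel_right₀ _ hs₀, halg, halg, ← map_sub, ← map_sub, ← map_mul] at hAB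
  refine not_exists_eq_sq_add_mul_sq two_ne_zero ha hg hc hcg ⟨A, RatFunc.C w * B, ?_⟩
  rw [hAB, hs]
  ring

theorem parametrization_of_odd {L : Type*} [Field L] {w a b c s : L} (hw : w ≠ 0) (k : ℕ)
    (hc : a * c = 1 - a ^ (2 * k + 1)) (hs : s = -w ^ 2 * a * (b ^ 2 - c)) :
    (a * s) ^ (2 * k + 1) + a * s * (s ^ k * b) ^ 2 + (s ^ k * (s / w)) ^ 2 = s ^ (2 * k + 1) := by
  have hsw : (s / w) ^ 2 = s * (1 - a ^ (2 * k + 1) - a * b ^ 2) := by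
    rw [← hc, div_pow, div_eq_iff (pow_ne_zero 2 hw)]
    linear_combination s * hs
  rw [mul_pow _ (s / w), hsw]
  ring

theorem parametrization_of_even {L : Type*} [Field L] {w a b c s : L} (hw : w ≠ 0) (ha : a ≠ 0)
    (k : ℕ) (hc : c = 1 - a ^ (2 * k + 2)) (hs : s = -w ^ 2 * a * (b ^ 2 - c)) :
    (a * s) ^ (2 * k + 2) + a * s * (s ^ k * (s / (a * w))) ^ 2 + (s ^ (k + 1) * b) ^ 2 =
      s ^ (2 * k + 2) := by
  have hsw : a * (s / (a * w)) ^ 2 = s * (1 - a ^ (2 * k + 2) - b ^ 2) := by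
    rw [← hc]
    field_simp
    linear_combination s * hs
  linear_combination s ^ (2 * k + 1) * hsw

/-- Rational parametrization of the base change, for both parities of `N`. -/
theorem exists_parametrization {F : Type} [Field F] [Algebra ℂ F] {w a : F} (hw : w ≠ 0)
    (ha : a ≠ 0) {N : ℕ} (hN : N ≠ 0) :
    ∃ (t : F) (j : ℕ) (s y z : RatFunc F), t ≠ 0 ∧
      s = -RatFunc.C w ^ 2 * RatFunc.C a *
        (RatFunc.X ^ 2 - RatFunc.C (t ^ 2 * (a ^ j * (1 - a ^ N)))) ∧
      (RatFunc.C a * s) ^ N + RatFunc.C a * s * y ^ 2 + z ^ 2 = s ^ N ∧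
      ∀ S : IntermediateField ℂ (RatFunc F), s ∈ S → RatFunc.C a ∈ S → y ∈ S → z ∈ S →
        RatFunc.C w ∈ S ∧ RatFunc.X ∈ S := by
  have hCw : (RatFunc.C w : RatFunc F) ≠ 0 := (map_ne_zero _).2 hw
  have hCa : (RatFunc.C a : RatFunc F) ≠ 0 := (map_ne_zero _).2 ha
  have hs0 : ∀ c, -RatFunc.C w ^ 2 * RatFunc.C a * (RatFunc.X ^ 2 - RatFunc.C c) ≠ 0 := fun c =>
    mul_ne_zero (mul_ne_zero (neg_ne_zero.2 (pow_ne_zero 2 hCw)) hCa) (RatFunc.X_sq_sub_C_ne_zero c)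
  obtain ⟨k, rfl | rfl⟩ : ∃ k, N = 2 * k + 1 ∨ N = 2 * k + 2 := ⟨(N - 1) / 2, by omega⟩
  · obtain ⟨s, hs⟩ : ∃ s, s = -RatFunc.C w ^ 2 * RatFunc.C a *
        (RatFunc.X ^ 2 - RatFunc.C (a⁻¹ ^ 2 * (a ^ 1 * (1 - a ^ (2 * k + 1))))) := ⟨_, rfl⟩
    have hs₀ : s ≠ 0 := hs ▸ hs0 _
    refine ⟨a⁻¹, 1, s, s ^ k * RatFunc.X, s ^ k * (s / RatFunc.C w), inv_ne_zero ha, hs,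
      parametrization_of_odd hCw k ?_ hs, fun S hsS haS hy hz => ⟨?_, ?_⟩⟩
    · rw [← map_mul, ← map_pow, ← map_one RatFunc.C, ← map_sub]
      congr 1
      field_simp
    · have := div_mem (pow_mem hsS (k + 1)) hz
      convert this using 1
      field_simp
      ring
    · have := div_mem hy (pow_mem hsS k)
      rwa [mul_div_cancel_left₀ _ (pow_ne_zero k hs₀)] at this
  · obtain ⟨s, hs⟩ : ∃ s, s = -RatFunc.C w ^ 2 * RatFunc.C a *
        (RatFunc.X ^ 2 - RatFunc.C (1 ^ 2 * (a ^ 0 * (1 - a ^ (2 * k + 2))))) := ⟨_, rfl⟩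
    have hs₀ : s ≠ 0 := hs ▸ hs0 _
    refine ⟨1, 0, s, s ^ k * (s / (RatFunc.C a * RatFunc.C w)), s ^ (k + 1) * RatFunc.X,
      one_ne_zero, hs, parametrization_of_even hCw hCa k (by simp) hs,
      fun S hsS haS hy hz => ⟨?_, ?_⟩⟩
    · have := div_mem (pow_mem hsS (k + 1)) (mul_mem haS hy)
      convert this using 1
      field_simp
      ring
    · have := div_mem hz (pow_mem hsS (k + 1))
      rwa [mul_div_cancel_left₀ _ (pow_ne_zero _ hs₀)] at this

theorem two_le_trdeg_ratFunc_ratFunc : (2 : ℕ) ≤ Algebra.trdeg ℂ (RatFunc (RatFunc ℂ)) := by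
  have h₁ := trdeg_add_one_le_trdeg_ratFunc ℂ ℂ
  have h₂ := trdeg_add_one_le_trdeg_ratFunc ℂ (RatFunc ℂ)
  calc ((2 : ℕ) : Cardinal) = 0 + 1 + 1 := by norm_num
    _ ≤ Algebra.trdeg ℂ ℂ + 1 + 1 := by gcongr; exact zero_le
    _ ≤ Algebra.trdeg ℂ (RatFunc ℂ) + 1 := by gcongr
    _ ≤ Algebra.trdeg ℂ (RatFunc (RatFunc ℂ)) := h₂

theorem dn_not_rational (n : ℕ) (hn : 4 ≤ n) :
    ¬ ∃ g h : Fxyz,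
      IntermediateField.adjoin ℂ {Vx ^ (n - 1) + Vx * Vy ^ 2 + Vz ^ 2, g, h} =
        (⊤ : IntermediateField ℂ Fxyz) := by
  rintro ⟨g', h', hgh⟩
  obtain ⟨N, rfl⟩ : ∃ N, n = N + 1 := ⟨n - 1, by omega⟩
  rw [Nat.add_sub_cancel] at hgh
  have hN0 : N ≠ 0 := by omega
  obtain ⟨ζ, hζ⟩ : ∃ ζ : ℂ, IsPrimitiveRoot ζ N := ⟨_, Complex.isPrimitiveRoot_exp N hN0⟩
  have h₁₂ : (1 : ℂ) ≠ ζ := fun h => by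
    simpa using hζ.pow_inj (i := 0) (j := 1) (by omega) (by omega) (by simpa using h)
  have h₁₃ : (1 : ℂ) ≠ ζ ^ 2 := fun h => by
    simpa using hζ.pow_inj (i := 0) (j := 2) (by omega) (by omega) (by simpa using h)
  have h₂₃ : ζ ≠ ζ ^ 2 := fun h => by
    simpa using hζ.pow_inj (i := 1) (j := 2) (by omega) (by omega) (by simpa using h)
  have hζ₃ : (ζ ^ 2) ^ N = 1 := by rw [← pow_mul, mul_comm, pow_mul, hζ.pow_eq_one, one_pow]
  have hCinj : Function.Injective (RatFunc.C : ℂ →+* RatFunc ℂ) := RingHom.injective _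
  let w : RatFunc (RatFunc ℂ) := RatFunc.C RatFunc.X
  let a : RatFunc (RatFunc ℂ) := RatFunc.X
  have hw : w ≠ 0 := (map_ne_zero _).2 RatFunc.X_ne_zero
  have ha : a ≠ 0 := RatFunc.X_ne_zero
  obtain ⟨t, j, s, y, z, ht, hs, heq, hgen⟩ :=
    exists_parametrization (F := RatFunc (RatFunc ℂ)) (w := w) (a := a) hw ha hN0
  obtain ⟨hg, hc, hcg⟩ := not_isSquare_ratFunc (j := j) hN0 (hCinj.ne h₁₂) (hCinj.ne h₁₃)
    (hCinj.ne h₂₃) (by rw [← map_pow, hζ₃, map_one]) ht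
  have : CharZero (RatFunc (RatFunc ℂ)) := algebraRat.charZero _
  refine adjoin_ne_top_of_parametrization two_le_trdeg_ratFunc_ratFunc hw ha (fun S hwS haS => ?_)
    hN0 (one_pow N) hζ.pow_eq_one hg hc hcg hs heq hgen g' h' hgh
  refine RatFunc.intermediateField_eq_top (RatFunc.C_mem_of_comap_eq_top ?_) haS
  exact RatFunc.intermediateField_eq_top (fun c => IntermediateField.algebraMap_mem _ c) hwS

end
end

section
/- There do not exist elements g, h ∈ ℂ(x,y,z) such that the subfield of ℂ(x,y,z) generated over ℂ by x⁴ + y³ + z², g, and h equals ℂ(x,y,z). That is, the field extension ℂ(x,y,z)/ℂ(e₆) with e₆ = x⁴ + y³ + z² is not rational. -/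
open MvPolynomial

noncomputable section

section PrimeValuation

open WithZero

theorem multiplicity_map_of_associated {B : Type*} [CommRing B] (σ : B ≃+* B) {p : B}
    (hσp : Associated (σ p) p) (a : B) :
    multiplicity p (σ a) = multiplicity p a := by
  rw [← multiplicity_map_eq σ (a := p) (b := a), multiplicity_eq_of_associated_left hσp]

variable {B : Type*} [CommRing B] [IsDomain B] [UniqueFactorizationMonoid B]

open Classical in
/-- The valuation on a unique factorization domain attached to a prime element. -/
def primeValuation {p : B} (hp : Prime p) : Valuation B ℤᵐ⁰ where
  toFun a := if a = 0 then 0 else exp (-(multiplicity p a : ℤ))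
  map_zero' := by simp
  map_one' := by simp [multiplicity_of_one_right hp.not_isUnit]
  map_mul' a b := by
    by_cases ha : a = 0
    · simp [ha]
    by_cases hb : b = 0
    · simp [hb]
    have hfin : FiniteMultiplicity p (a * b) :=
      FiniteMultiplicity.of_prime_left hp (mul_ne_zero ha hb)
    simp only [mul_eq_zero, ha, hb, or_self, if_false, multiplicity_mul hp hfin]
    rw [← exp_add]
    congr 1
    push_cast
    ring
  map_add_le_max' a b := by
    by_cases ha : a = 0
    · simp [ha]
    by_cases hb : b = 0
    · simp [hb]
    by_cases hab : a + b = 0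
    · simp [hab]
    have hfa : FiniteMultiplicity p a := FiniteMultiplicity.of_prime_left hp ha
    have hfb : FiniteMultiplicity p b := FiniteMultiplicity.of_prime_left hp hb
    have hfab : FiniteMultiplicity p (a + b) := FiniteMultiplicity.of_prime_left hp hab
    have h := min_le_emultiplicity_add (p := p) (a := a) (b := b)
    rw [hfa.emultiplicity_eq_multiplicity, hfb.emultiplicity_eq_multiplicity,
      hfab.emultiplicity_eq_multiplicity, min_le_iff] at h
    simp only [ha, hb, hab, if_false, le_max_iff, exp_le_exp, neg_le_neg_iff, Nat.cast_le]
    simpa using h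

theorem primeValuation_of_ne_zero {p : B} (hp : Prime p) {a : B} (ha : a ≠ 0) :
    primeValuation hp a = exp (-(multiplicity p a : ℤ)) := by
  simp [primeValuation, ha]

theorem primeValuation_unit {p : B} (hp : Prime p) (u : Bˣ) : primeValuation hp (u : B) = 1 := by
  rw [primeValuation_of_ne_zero hp u.ne_zero, multiplicity_eq_zero.2]
  · simp
  · exact fun h => hp.not_isUnit (isUnit_of_dvd_unit h u.isUnit)

theorem primeValuation_map_of_associated (σ : B ≃+* B) {p : B} (hp : Prime p)
    (hσp : Associated (σ p) p) (a : B) : primeValuation hp (σ a) = primeValuation hp a := by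
  by_cases ha : a = 0
  · simp [ha]
  rw [primeValuation_of_ne_zero hp ha, primeValuation_of_ne_zero hp (by simpa using ha),
    multiplicity_map_of_associated σ hσp]

end PrimeValuation

section CyclicNorm

open WithZero

variable {B : Type*} [CommRing B] [IsDomain B] [UniqueFactorizationMonoid B]

/-- An invariant element of a unique factorization domain with an automorphism of order three is
a unit times a norm as soon as every invariant prime occurs in it with multiplicity divisible
by three. -/
theorem exists_eq_unit_mul_norm (σ : B ≃+* B) (hσ : ∀ b, σ (σ (σ b)) = b) (n : B) (hn : n ≠ 0)
    (hσn : σ n = n) (hm : ∀ p, Prime p → Associated (σ p) p → 3 ∣ multiplicity p n) :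
    ∃ (u : Bˣ) (a : B), n = u * (a * σ a * σ (σ a)) := by
  induction n using (wellFounded_dvdNotUnit (α := B)).induction with
  | _ n ih =>
  by_cases hu : IsUnit n
  · exact ⟨hu.unit, 1, by simp⟩
  obtain ⟨p, hpi, hpn⟩ := WfDvdMonoid.exists_irreducible_factor hu hn
  have hp : Prime p := hpi.prime
  have key : p * σ p * σ (σ p) ∣ n := by
    by_cases hass : Associated (σ p) p
    · have h3 := hm p hp hass
      have hfin : FiniteMultiplicity p n := FiniteMultiplicity.of_prime_left hp hn
      have hpos : multiplicity p n ≠ 0 := fun h => (multiplicity_eq_zero.1 h) hpn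
      have hdvd : p ^ 3 ∣ n := (pow_dvd_pow p (Nat.le_of_dvd (Nat.pos_of_ne_zero hpos) h3)).trans
        (pow_multiplicity_dvd p n)
      have hass' : Associated (σ (σ p)) p := (hass.map σ).trans hass
      have : Associated (p * σ p * σ (σ p)) (p ^ 3) := by
        rw [show p ^ 3 = p * p * p by ring]
        exact ((Associated.refl p).mul_mul hass).mul_mul hass'
      exact this.dvd.trans hdvd
    · have h1 : Prime (σ p) := (MulEquiv.prime_iff σ).2 hp
      have h2 : Prime (σ (σ p)) := (MulEquiv.prime_iff σ).2 h1
      have d1 : σ p ∣ n := hσn ▸ map_dvd σ hpn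
      have d2 : σ (σ p) ∣ n := hσn ▸ map_dvd σ d1
      have n1 : ¬ p ∣ σ p := fun h => hass (hp.associated_of_dvd h1 h).symm
      have n2 : ¬ σ p ∣ σ (σ p) := fun h =>
        n1 (by simpa using map_dvd σ.symm h)
      have n3 : ¬ p ∣ σ (σ p) := by
        intro h
        have h' := map_dvd σ (hp.associated_of_dvd h2 h).symm.dvd
        rw [hσ] at h'
        exact n1 h'
      obtain ⟨c, rfl⟩ := hpn
      obtain ⟨c, rfl⟩ := (h1.dvd_or_dvd d1).resolve_left
        (fun h => hass (h1.associated_of_dvd hp h))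
      have d2' : σ (σ p) ∣ (p * σ p) * c := by rwa [mul_assoc]
      have := (h2.dvd_or_dvd d2').resolve_left (fun h => by
        rcases h2.dvd_or_dvd h with h | h
        · exact n3 (h2.associated_of_dvd hp h).symm.dvd
        · exact n2 (h2.associated_of_dvd h1 h).symm.dvd)
      rw [← mul_assoc]
      exact mul_dvd_mul_left _ this
  obtain ⟨c, rfl⟩ := key
  have hN : p * σ p * σ (σ p) ≠ 0 := left_ne_zero_of_mul hn
  have hc : c ≠ 0 := right_ne_zero_of_mul hn
  have hσc : σ c = c := by
    apply mul_left_cancel₀ hN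
    rw [← hσn]
    simp only [map_mul, hσ]
    ring
  obtain ⟨u, a, rfl⟩ := ih c ⟨hc, _, fun h => hp.not_isUnit (isUnit_of_mul_isUnit_left
      (isUnit_of_mul_isUnit_left h)), mul_comm _ _⟩ hc hσc (by
    intro q hq hqa
    have h := hm q hq hqa
    rw [multiplicity_mul hq (FiniteMultiplicity.of_prime_left hq hn),
      multiplicity_mul hq (FiniteMultiplicity.of_prime_left hq hN),
      multiplicity_mul hq (FiniteMultiplicity.of_prime_left hq (left_ne_zero_of_mul hN)),
      multiplicity_map_of_associated σ hqa, multiplicity_map_of_associated σ hqa,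
      multiplicity_map_of_associated σ hqa] at h
    omega)
  exact ⟨u, p * a, by simp only [map_mul]; ring⟩

/-- An invariant element of the fraction field whose value at every invariant valuation is a cube
is a unit times a norm. -/
theorem exists_eq_unit_mul_norm_of_valuation {L : Type*} [Field L] [Algebra B L]
    [IsFractionRing B L] (σ : B ≃+* B) (hσ : ∀ b, σ (σ (σ b)) = b) (τ : L ≃+* L)
    (hτ : ∀ b, τ (algebraMap B L b) = algebraMap B L (σ b)) (F : L) (hF : F ≠ 0) (hτF : τ F = F)
    (hv : ∀ v : Valuation L ℤᵐ⁰, (∀ x, v (τ x) = v x) →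
      (∀ u : Bˣ, v (algebraMap B L u) = 1) → ∃ γ, v F = γ ^ 3) :
    ∃ (u : Bˣ) (G : L), F = algebraMap B L u * (G * τ G * τ (τ G)) := by
  obtain ⟨a, d, hd, rfl⟩ := IsFractionRing.div_surjective (A := B) F
  have hd0 : d ≠ 0 := nonZeroDivisors.ne_zero hd
  have hinj := IsFractionRing.injective B L
  have hdL : algebraMap B L d ≠ 0 := by simpa using hd0
  have hsd : σ d ≠ 0 := by simpa using hd0
  have hssd : σ (σ d) ≠ 0 := by simpa using hsd
  have hsdL : algebraMap B L (σ d) ≠ 0 := by simpa using hsd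
  have hssdL : algebraMap B L (σ (σ d)) ≠ 0 := by simpa using hssd
  have ha0 : a ≠ 0 := by rintro rfl; simp at hF
  have hn0 : a * σ d * σ (σ d) ≠ 0 := by simp [ha0, hsd, hssd]
  have hcross : σ a * d = a * σ d := by
    rw [map_div₀, hτ, hτ, div_eq_div_iff hsdL hdL, ← map_mul, ← map_mul] at hτF
    exact hinj hτF
  obtain ⟨u, c, hc⟩ := exists_eq_unit_mul_norm σ hσ (a * σ d * σ (σ d)) hn0
    (by simp only [map_mul, hσ]; linear_combination σ (σ d) * hcross) (by
    intro p hp hpa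
    have hS : nonZeroDivisors B ≤ (primeValuation hp).supp.primeCompl := by
      intro b hb hb'
      have hb0 := nonZeroDivisors.ne_zero hb
      have : primeValuation hp b = 0 := hb'
      rw [primeValuation_of_ne_zero hp hb0] at this
      exact exp_ne_zero this
    let v := (primeValuation hp).extendToLocalization hS L
    have hvB : ∀ b, v (algebraMap B L b) = primeValuation hp b := fun b =>
      Valuation.extendToLocalization_apply_map_apply _ hS L b
    obtain ⟨γ, hγ⟩ := hv v (by
      intro x
      obtain ⟨r, s, -, rfl⟩ := IsFractionRing.div_surjective (A := B) x
      simp only [map_div₀, hτ, hvB, primeValuation_map_of_associated σ hp hpa]) (by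
      intro w
      rw [hvB, primeValuation_unit])
    have hvd : primeValuation hp d ≠ 0 := hS hd
    rw [map_div₀, hvB, hvB, div_eq_iff hvd] at hγ
    have hcube : primeValuation hp (a * σ d * σ (σ d)) = (γ * primeValuation hp d) ^ 3 := by
      simp only [map_mul, primeValuation_map_of_associated σ hp hpa, hγ, mul_pow]
      simp only [pow_succ, pow_zero, one_mul, mul_assoc]
    rw [primeValuation_of_ne_zero hp hn0] at hcube
    have hne : γ * primeValuation hp d ≠ 0 := by
      intro h
      rw [h] at hcube
      simp at hcube
    rw [← exp_log hne, ← exp_nsmul, exp_inj] at hcube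
    have : (3 : ℤ) ∣ (multiplicity p (a * σ d * σ (σ d)) : ℤ) :=
      ⟨-log (γ * primeValuation hp d), by simp at hcube; linarith⟩
    exact_mod_cast this)
  refine ⟨u, algebraMap B L c / algebraMap B L d, ?_⟩
  have hc' := congrArg (algebraMap B L) hc
  simp only [map_mul] at hc'
  simp only [map_div₀, hτ]
  field_simp
  linear_combination hc'

end CyclicNorm

section ValuationCube

variable {L Γ : Type*} [Field L] [Algebra ℂ L] [LinearOrderedCommGroupWithZero Γ]

theorem exists_cube_root_valuation_of_integral (v : Valuation L Γ)
    (hv : ∀ c : ℂ, c ≠ 0 → v (algebraMap ℂ L c) = 1) {ω : ℂ} (hω : ω ≠ 1) {Y Z m q : L}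
    (hprod : v (Z - q) * v (Z + q) = v (m - Y) ^ 3)
    (hinv : v (m - algebraMap ℂ L ω * Y) = v (m - Y)) (hωv : v (algebraMap ℂ L ω) ≤ 1)
    (hZ : v Z ≤ 1) (hq : v q ≤ 1) (hmq : v m < 1 → 1 ≤ v q) :
    ∃ γ, v (Z - q) = γ ^ 3 := by
  rcases (v.map_add_le hZ hq).lt_or_eq with hlt | heq
  · rcases (v.map_sub_le hZ hq).lt_or_eq with hlt' | heq'
    · exfalso
      have hq1 : v q < 1 := by
        have h2 : v (algebraMap ℂ L 2 * q) < 1 := by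
          have : algebraMap ℂ L 2 * q = (Z + q) - (Z - q) := by
            rw [map_ofNat]; ring
          rw [this]
          exact v.map_sub_lt hlt hlt'
        rwa [map_mul, hv 2 two_ne_zero, one_mul] at h2
      have hmY : v (m - Y) < 1 := by
        have h3 : v (m - Y) ^ 3 < 1 := by
          rw [← hprod]
          exact mul_lt_one_of_lt_of_le hlt' hlt.le
        by_contra! hge
        exact h3.not_ge (one_le_pow₀ hge)
      have hm1 : v m < 1 := by
        have h1 : v (algebraMap ℂ L (1 - ω) * m) < 1 := by
          have : algebraMap ℂ L (1 - ω) * m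
              = (m - algebraMap ℂ L ω * Y) - algebraMap ℂ L ω * (m - Y) := by
            rw [map_sub, map_one]; ring
          rw [this]
          refine v.map_sub_lt (by rwa [hinv]) ?_
          rw [map_mul]
          exact mul_lt_one_of_nonneg_of_lt_one_right hωv zero_le hmY
        rwa [map_mul, hv _ (sub_ne_zero.2 hω.symm), one_mul] at h1
      exact (hmq hm1).not_gt hq1
    · exact ⟨1, by rw [heq', one_pow]⟩
  · exact ⟨v (m - Y), by rw [← hprod, heq, mul_one]⟩

/-- On the surface `X ^ 4 + Y ^ 3 + Z ^ 2 = 1` the quotient of the two functions `Z - (quadratic)`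
attached to tangent quadratics in `X` with a common leading coefficient has cubes as values at all
valuations invariant under `Y ↦ ω Y`. -/
theorem exists_cube_root_valuation_div (v : Valuation L Γ)
    (hv : ∀ c : ℂ, c ≠ 0 → v (algebraMap ℂ L c) = 1) {ω I α β γ x₀ : ℂ} (hω : IsPrimitiveRoot ω 3)
    (hI : I ^ 2 = -1) (hα : α ≠ 0) (hx₀ : I * x₀ ^ 2 + β * x₀ + γ ≠ 0) {X Y Z q q' m : L}
    (hXYZ : X ^ 4 + Y ^ 3 + Z ^ 2 = 1)
    (hq : q = algebraMap ℂ L I * X ^ 2 + algebraMap ℂ L β * X + algebraMap ℂ L γ)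
    (hq' : q' = algebraMap ℂ L I * X ^ 2) (hm : m = algebraMap ℂ L α * (X - algebraMap ℂ L x₀))
    (hqm : 1 - X ^ 4 - q ^ 2 = m ^ 3)
    (hinv : ∀ n ∈ ({m, 1} : Set L), v (n - algebraMap ℂ L ω * Y) = v (n - Y) ∧
      v (n - algebraMap ℂ L (ω ^ 2) * Y) = v (n - Y)) :
    ∃ δ, v ((Z - q) / (Z - q')) = δ ^ 3 := by
  have hvle : ∀ c : ℂ, v (algebraMap ℂ L c) ≤ 1 := by
    intro c
    by_cases hc : c = 0
    · simp [hc]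
    · exact (hv c hc).le
  have hI0 : I ≠ 0 := by rintro rfl; norm_num at hI
  have hIL : algebraMap ℂ L I ^ 2 = -1 := by rw [← map_pow, hI]; simp
  have hω1 : ω ≠ 1 := hω.ne_one (by norm_num)
  have hωsum : 1 + ω + ω ^ 2 = 0 := by
    have := hω.geom_sum_eq_zero (by norm_num)
    simpa [Finset.sum_range_succ] using this
  have hω3 : ω ^ 3 = 1 := hω.pow_eq_one
  have hfact : ∀ n : L, n ^ 3 - Y ^ 3
      = (n - Y) * (n - algebraMap ℂ L ω * Y) * (n - algebraMap ℂ L (ω ^ 2) * Y) := by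
    intro n
    have h1 : 1 + algebraMap ℂ L ω + algebraMap ℂ L ω ^ 2 = 0 := by
      rw [← map_pow, ← map_one (algebraMap ℂ L), ← map_add, ← map_add, hωsum, map_zero]
    rw [map_pow]
    linear_combination (n ^ 2 * Y - n * Y ^ 2 * algebraMap ℂ L ω
      + Y ^ 3 * (algebraMap ℂ L ω - 1)) * h1
  have hprod : ∀ n p : L, n ∈ ({m, 1} : Set L) → 1 - X ^ 4 - p ^ 2 = n ^ 3 →
      v (Z - p) * v (Z + p) = v (n - Y) ^ 3 := by
    intro n p hn hnp
    have : (Z - p) * (Z + p) = n ^ 3 - Y ^ 3 := by linear_combination hXYZ + hnp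
    rw [← map_mul, this, hfact, map_mul, map_mul, (hinv n hn).1, (hinv n hn).2]
    simp only [pow_succ, pow_zero, one_mul]
  have hqm' : 1 - X ^ 4 - q' ^ 2 = (1 : L) ^ 3 := by
    rw [hq']
    linear_combination (-X ^ 4) * hIL
  have hdiff : (Z - q') - (Z - q) = algebraMap ℂ L β * X + algebraMap ℂ L γ := by
    rw [hq, hq']; ring
  have hp := hprod m q (by simp) hqm
  have hp' := hprod 1 q' (by simp) hqm'
  rcases le_or_gt (v X) 1 with hX | hX
  · have hq'1 : v q' ≤ 1 := by
      rw [hq', map_mul, map_pow, hv I hI0, one_mul]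
      exact pow_le_one₀ zero_le hX
    have hlin : v (algebraMap ℂ L β * X + algebraMap ℂ L γ) ≤ 1 := by
      refine v.map_add_le ?_ (hvle γ)
      rw [map_mul]
      exact mul_le_one' (hvle β) hX
    have hq1 : v q ≤ 1 := by
      have : q = q' + (algebraMap ℂ L β * X + algebraMap ℂ L γ) := by rw [hq, hq']; ring
      rw [this]
      exact v.map_add_le hq'1 hlin
    rcases le_or_gt (v Z) 1 with hZ | hZ
    · obtain ⟨a, ha⟩ := exists_cube_root_valuation_of_integral v hv hω1 hp
        (hinv m (by simp)).1 (hvle ω) hZ hq1 (by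
        intro hm1
        rw [hm, map_mul, hv α hα, one_mul] at hm1
        have : q = algebraMap ℂ L (I * x₀ ^ 2 + β * x₀ + γ) + (X - algebraMap ℂ L x₀) *
            (algebraMap ℂ L I * X + algebraMap ℂ L (I * x₀ + β)) := by
          rw [hq]; simp only [map_add, map_mul, map_pow]; ring
        rw [this, Valuation.map_add_eq_of_lt_left, hv _ hx₀]
        rw [hv _ hx₀, map_mul]
        refine mul_lt_one_of_lt_of_le hm1 (v.map_add_le ?_ (hvle _))
        rw [map_mul]
        exact mul_le_one' (hvle I) hX)
      obtain ⟨b, hb⟩ := exists_cube_root_valuation_of_integral v hv hω1 hp'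
        (hinv 1 (by simp)).1 (hvle ω) hZ hq'1 (by simp)
      exact ⟨a / b, by rw [map_div₀, ha, hb, div_pow]⟩
    · have h1 : v (Z - q) = v Z := v.map_sub_eq_of_lt_left (hq1.trans_lt hZ)
      have h2 : v (Z - q') = v Z := v.map_sub_eq_of_lt_left (hq'1.trans_lt hZ)
      refine ⟨1, ?_⟩
      rw [map_div₀, h1, h2, div_self (zero_lt_one.trans hZ).ne', one_pow]
  · have hlin : v (algebraMap ℂ L β * X + algebraMap ℂ L γ) ≤ v X := by
      refine v.map_add_le ?_ ((hvle γ).trans hX.le)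
      rw [map_mul]
      exact mul_le_of_le_one_left' (hvle β)
    have hXX : v X < v X ^ 2 := by
      rw [sq]
      exact lt_mul_of_one_lt_right (zero_lt_one.trans hX) hX
    have hX0 : v X ^ 2 ≠ 0 := (zero_lt_one.trans (hX.trans hXX)).ne'
    have hq'v : v q' = v X ^ 2 := by rw [hq', map_mul, map_pow, hv I hI0, one_mul]
    have hqv : v q = v X ^ 2 := by
      have : q = q' + (algebraMap ℂ L β * X + algebraMap ℂ L γ) := by rw [hq, hq']; ring
      rw [this, v.map_add_eq_of_lt_left, hq'v]
      rw [hq'v]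
      exact hlin.trans_lt hXX
    have hplus : ∀ p : L, v p = v X ^ 2 → v (Z - p) ≤ v X → v (Z + p) = v X ^ 2 := by
      intro p hpv hle
      have h2p : v (algebraMap ℂ L 2 * p) = v X ^ 2 := by
        rw [map_mul, hv 2 two_ne_zero, one_mul, hpv]
      have : Z + p = (Z - p) + algebraMap ℂ L 2 * p := by rw [map_ofNat]; ring
      rw [this, v.map_add_eq_of_lt_right, h2p]
      rw [h2p]
      exact hle.trans_lt hXX
    by_cases hab : v (Z - q) = v (Z - q')
    · by_cases h0 : v (Z - q') = 0
      · exact ⟨0, by rw [map_div₀, h0]; simp⟩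
      · exact ⟨1, by rw [map_div₀, hab, div_self h0, one_pow]⟩
    · have hmax : max (v (Z - q')) (v (Z - q)) ≤ v X := by
        rw [← hdiff] at hlin
        rcases lt_or_gt_of_ne hab with h | h
        · rw [v.map_sub_eq_of_lt_left h] at hlin
          exact max_le hlin (h.le.trans hlin)
        · rw [v.map_sub_eq_of_lt_right h] at hlin
          exact max_le (h.le.trans hlin) hlin
      rw [hplus q hqv ((le_max_right _ _).trans hmax)] at hp
      rw [hplus q' hq'v ((le_max_left _ _).trans hmax)] at hp'
      refine ⟨v (m - Y) / v (1 - Y), ?_⟩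
      rw [map_div₀, div_pow, ← hp, ← hp', mul_div_mul_right _ _ hX0]

/-- The constants of a quadratic `I x ^ 2 + β x + γ` osculating the curve `z ^ 2 = 1 - x ^ 4`. -/
theorem exists_tangent_quadratic : ∃ I α β γ x₀ : ℂ, I ^ 2 = -1 ∧ α ≠ 0 ∧ β ≠ 0 ∧
    I * x₀ ^ 2 + β * x₀ + γ ≠ 0 ∧ -2 * I * β = α ^ 3 ∧ β ^ 2 + 2 * I * γ = 3 * α ^ 3 * x₀ ∧
    -2 * β * γ = 3 * α ^ 3 * x₀ ^ 2 ∧ 1 - γ ^ 2 = -α ^ 3 * x₀ ^ 3 := by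
  obtain ⟨I, hI⟩ := IsAlgClosed.exists_pow_nat_eq (-1 : ℂ) (n := 2) (by norm_num)
  obtain ⟨r, hr⟩ := IsAlgClosed.exists_pow_nat_eq (3 : ℂ) (n := 2) (by norm_num)
  obtain ⟨x, hx⟩ := IsAlgClosed.exists_pow_nat_eq (1 + 2 * r / 3 : ℂ) (n := 4) (by norm_num)
  have hx8 : 3 * x ^ 8 = 6 * x ^ 4 + 1 := by
    rw [show x ^ 8 = (x ^ 4) ^ 2 by ring, hx]
    linear_combination 4 / 3 * hr
  have hx0 : x ≠ 0 := by rintro rfl; norm_num at hx8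
  have hd : 1 - x ^ 4 ≠ 0 := by
    intro h
    have h' : x ^ 4 = 1 := by linear_combination -h
    rw [show x ^ 8 = (x ^ 4) ^ 2 by ring, h'] at hx8
    norm_num at hx8
  have hrel : (x ^ 6 - 3 * x ^ 2) ^ 2 = -(1 - x ^ 4) ^ 3 := by linear_combination -hx8
  obtain ⟨y, hy⟩ : ∃ y, y * (1 - x ^ 4) = -I * (x ^ 6 - 3 * x ^ 2) :=
    ⟨-I * (x ^ 6 - 3 * x ^ 2) / (1 - x ^ 4), by field_simp⟩
  have hy2 : y ^ 2 = 1 - x ^ 4 := by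
    apply mul_right_cancel₀ (pow_ne_zero 2 hd)
    rw [← mul_pow, hy]
    linear_combination (x ^ 6 - 3 * x ^ 2) ^ 2 * hI - hrel
  have hy3 : y ^ 3 = -I * (x ^ 6 - 3 * x ^ 2) := by
    rw [← hy, ← hy2]; ring
  have hy0 : y ≠ 0 := by rintro rfl; exact hd (by rw [← hy2]; norm_num)
  obtain ⟨s, hs⟩ : ∃ s, s * y = -2 * x ^ 3 := ⟨-2 * x ^ 3 / y, by field_simp⟩
  have hβ : s - 2 * I * x ≠ 0 := by
    intro h
    have h1 : x * (x ^ 2 + I * y) = 0 := by linear_combination (-1 / 2) * y * h + 1 / 2 * hs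
    have h2 : x ^ 2 = -I * y := by
      linear_combination (mul_eq_zero.1 h1).resolve_left hx0
    have h3 : x ^ 4 = -y ^ 2 := by
      rw [show x ^ 4 = (x ^ 2) ^ 2 by ring, h2]; linear_combination y ^ 2 * hI
    rw [hy2] at h3
    exact one_ne_zero (by linear_combination h3 : (1 : ℂ) = 0)
  obtain ⟨α, hα⟩ := IsAlgClosed.exists_pow_nat_eq (-2 * I * (s - 2 * I * x)) (n := 3) (by norm_num)
  have hI0 : I ≠ 0 := by rintro rfl; norm_num at hI
  have hs2 : s ^ 2 + 2 * I * y = -6 * x ^ 2 := by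
    apply mul_right_cancel₀ (pow_ne_zero 2 hy0)
    linear_combination (s * y - 2 * x ^ 3) * hs + 2 * I * hy3 + 6 * x ^ 2 * hy2
      - 2 * (x ^ 6 - 3 * x ^ 2) * hI
  refine ⟨I, α, s - 2 * I * x, y - s * x + I * x ^ 2, x, hI, ?_, hβ, ?_, hα.symm, ?_, ?_, ?_⟩
  · rintro rfl
    simp [hI0, hβ] at hα
  · intro h; exact hy0 (by linear_combination h)
  · rw [hα]; linear_combination hs2 + (-6 * x ^ 2) * hI
  · rw [hα]; linear_combination -2 * hs + 2 * x * hs2 - 8 * x ^ 3 * hI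
  · rw [neg_mul, hα]; linear_combination -hy2 + 2 * x * hs - x ^ 2 * hs2 + 3 * x ^ 4 * hI

end ValuationCube

namespace Polynomial

section EllipticCube

theorem squarefree_one_sub_X_pow_four : Squarefree (1 - X ^ 4 : ℂ[X]) := by
  have h : (X ^ 4 - 1 : ℂ[X]).Separable := by
    simpa using separable_X_pow_sub_C (1 : ℂ) (n := 4) (by norm_num) one_ne_zero
  rw [show (1 - X ^ 4 : ℂ[X]) = -(X ^ 4 - 1) by ring]
  intro x hx
  exact h.squarefree x ((dvd_neg (α := ℂ[X])).1 hx)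

theorem natDegree_one_sub_X_pow_four : (1 - X ^ 4 : ℂ[X]).natDegree = 4 := by
  compute_degree!

/-- Cube roots of `(z - q) * (z + I * x ^ 2)` on the curve `z ^ 2 = 1 - x ^ 4`, written as
`a + b * z`, do not exist. -/
theorem false_of_cube_on_curve {K : Type*} [Field K] [Algebra ℂ[X] K] [IsFractionRing ℂ[X] K]
    {A ℓ m : ℂ[X]} (hA : A.natDegree ≤ 3) (hm : m.natDegree ≤ 1) (hℓ : ℓ ≠ 0)
    (hnorm : A ^ 2 - ℓ ^ 2 * (1 - X ^ 4) = m ^ 3) (a b : K)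
    (h₁ : a ^ 3 + 3 * a * b ^ 2 * algebraMap ℂ[X] K (1 - X ^ 4) = algebraMap ℂ[X] K A)
    (h₂ : 3 * a ^ 2 * b + b ^ 3 * algebraMap ℂ[X] K (1 - X ^ 4) = algebraMap ℂ[X] K ℓ) :
    False := by
  have hinj := IsFractionRing.injective ℂ[X] K
  have hsf := squarefree_one_sub_X_pow_four
  have hdegT := natDegree_one_sub_X_pow_four
  generalize (1 - X ^ 4 : ℂ[X]) = T at *
  have hT0 : T ≠ 0 := hsf.ne_zero
  have hTK : algebraMap ℂ[X] K T ≠ 0 := by simpa using hT0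
  have hμ3 : (a ^ 2 - b ^ 2 * algebraMap ℂ[X] K T) ^ 3 = algebraMap ℂ[X] K (m ^ 3) := by
    rw [← hnorm, map_sub, map_mul, map_pow, map_pow, ← h₁, ← h₂]; ring
  obtain ⟨μ, hμ⟩ := IsIntegrallyClosed.exists_algebraMap_eq_of_isIntegral_pow (R := ℂ[X])
    (n := 3) (by norm_num) (hμ3 ▸ isIntegral_algebraMap)
  have hμm : μ ^ 3 = m ^ 3 := hinj (by rw [map_pow, hμ, hμ3])
  have hμdeg : μ.natDegree ≤ 1 := by
    have := congrArg natDegree hμm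
    rw [natDegree_pow, natDegree_pow] at this
    omega
  have ha : 4 * a ^ 3 - 3 * algebraMap ℂ[X] K μ * a = algebraMap ℂ[X] K A := by
    rw [← h₁, hμ]; ring
  have haint : IsIntegral ℂ[X] a := by
    have h4 : algebraMap ℂ[X] K (C (1 / 4)) * 4 = 1 := by
      rw [← map_ofNat (algebraMap ℂ[X] K) 4, ← map_mul, ← map_ofNat C 4, ← C_mul]
      norm_num
    refine ⟨X ^ 3 - (C (C (3 / 4) * μ) * X + C (C (1 / 4) * A)), ?_, ?_⟩
    · apply monic_X_pow_sub
      exact degree_linear_le.trans_lt (by norm_num)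
    · have h34 : algebraMap ℂ[X] K (C (3 / 4)) = 3 * algebraMap ℂ[X] K (C (1 / 4)) := by
        rw [← map_ofNat (algebraMap ℂ[X] K) 3, ← map_mul, ← map_ofNat C 3, ← C_mul]
        norm_num
      simp only [eval₂_sub, eval₂_add, eval₂_mul, eval₂_C, eval₂_X, eval₂_X_pow, map_mul, h34]
      linear_combination algebraMap ℂ[X] K (C (1 / 4)) * ha - a ^ 3 * h4
  obtain ⟨a, rfl⟩ := IsIntegrallyClosed.isIntegral_iff.1 haint
  have ha' : 4 * a ^ 3 - 3 * μ * a = A := hinj (by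
    simp only [map_sub, map_mul, map_pow, map_ofNat]; exact ha)
  have hadeg : a.natDegree ≤ 1 := by
    by_contra! hlt
    have h4 : (4 * a ^ 3 : ℂ[X]).natDegree = 3 * a.natDegree := by
      rw [← map_ofNat C 4, natDegree_C_mul (by norm_num), natDegree_pow]
    have h3 : (3 * μ * a : ℂ[X]).natDegree ≤ 1 + a.natDegree := by
      rw [← map_ofNat C 3, mul_assoc]
      exact (natDegree_C_mul_le _ _).trans (natDegree_mul_le.trans (by omega))
    have : (4 * a ^ 3 : ℂ[X]).natDegree ≤ max A.natDegree (3 * μ * a).natDegree := by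
      rw [show 4 * a ^ 3 = A + 3 * μ * a by linear_combination ha']
      exact natDegree_add_le _ _
    rcases le_max_iff.1 this with h | h <;> omega
  have hb2 : b ^ 2 * algebraMap ℂ[X] K T = algebraMap ℂ[X] K (a ^ 2 - μ) := by
    rw [map_sub, hμ, map_pow]; ring
  have hbT : (b * algebraMap ℂ[X] K T) ^ 2 = algebraMap ℂ[X] K ((a ^ 2 - μ) * T) := by
    rw [map_mul, ← hb2]; ring
  obtain ⟨c, hc⟩ := IsIntegrallyClosed.exists_algebraMap_eq_of_isIntegral_pow (R := ℂ[X])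
    (n := 2) (by norm_num) (hbT ▸ isIntegral_algebraMap)
  have hc2 : c ^ 2 = (a ^ 2 - μ) * T := hinj (by rw [map_pow, hc, hbT])
  obtain ⟨d, rfl⟩ : T ∣ c := (hsf.dvd_pow_iff_dvd two_ne_zero).1 ⟨_, hc2.trans (mul_comm _ _)⟩
  have hbd : b = algebraMap ℂ[X] K d := by
    apply mul_right_cancel₀ hTK
    rw [← hc, map_mul, mul_comm]
  have hd : d ^ 2 * T = a ^ 2 - μ := hinj (by rw [← hb2, hbd]; simp)
  have hd0 : d ≠ 0 := by
    rintro rfl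
    rw [hbd] at h₂
    exact hℓ (hinj (by simpa using h₂.symm))
  have h1 := congrArg natDegree hd
  rw [natDegree_mul (pow_ne_zero 2 hd0) hT0, natDegree_pow, hdegT] at h1
  have h2 : (a ^ 2 - μ).natDegree ≤ 2 :=
    (natDegree_sub_le _ _).trans (max_le (natDegree_pow_le.trans (by omega)) (by omega))
  omega

end EllipticCube

section Descent

/-- The rational function `1 - x ^ 4`. -/
def oneSubQuartic : FractionRing ℂ[X] := algebraMap ℂ[X] _ (1 - X ^ 4)

/-- The function field of the curve `z ^ 2 = 1 - x ^ 4`. -/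
abbrev CurveField : Type := QuadraticAlgebra (FractionRing ℂ[X]) oneSubQuartic 0

instance fact_oneSubQuartic_not_square : Fact (∀ r : FractionRing ℂ[X],
    r ^ 2 ≠ oneSubQuartic + 0 * r) := ⟨by
  intro r hr
  rw [oneSubQuartic, zero_mul, add_zero] at hr
  obtain ⟨c, rfl⟩ := IsIntegrallyClosed.exists_algebraMap_eq_of_isIntegral_pow (R := ℂ[X])
    (n := 2) (by norm_num) (hr ▸ isIntegral_algebraMap)
  have hc : c ^ 2 = 1 - X ^ 4 :=
    IsFractionRing.injective ℂ[X] (FractionRing ℂ[X]) (by simpa using hr)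
  have hu : IsUnit c := squarefree_one_sub_X_pow_four c ⟨1, by rw [← hc]; ring⟩
  have h := congrArg natDegree hc
  rw [natDegree_pow, natDegree_eq_zero_of_isUnit hu, natDegree_one_sub_X_pow_four] at h
  omega⟩

/-- Restriction of polynomial functions to the curve `z ^ 2 = 1 - x ^ 4`. -/
def toCurveField : ℂ[X][X] →+* CurveField :=
  eval₂RingHom ((algebraMap (FractionRing ℂ[X]) CurveField).comp
    (algebraMap ℂ[X] (FractionRing ℂ[X]))) QuadraticAlgebra.omega

theorem toCurveField_C (p : ℂ[X]) : toCurveField (C p) =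
    algebraMap (FractionRing ℂ[X]) CurveField (algebraMap ℂ[X] (FractionRing ℂ[X]) p) := by
  simp [toCurveField]

theorem toCurveField_X : toCurveField X = QuadraticAlgebra.omega := by
  simp [toCurveField]

theorem toCurveField_eq_zero_iff (p : ℂ[X][X]) :
    toCurveField p = 0 ↔ C (1 - X ^ 4) - X ^ 2 ∣ p := by
  have hc : toCurveField (C (1 - X ^ 4) - X ^ 2) = 0 := by
    rw [map_sub, map_pow, toCurveField_C, toCurveField_X, ← oneSubQuartic]
    ext <;> simp [sq]
  constructor
  · intro h
    have hmonic : (X ^ 2 - C (1 - X ^ 4) : ℂ[X][X]).Monic := monic_X_pow_sub_C _ two_ne_zero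
    have hdvd : X ^ 2 - C (1 - X ^ 4) ∣ p := by
      rw [← modByMonic_eq_zero_iff_dvd hmonic]
      set r := p %ₘ (X ^ 2 - C (1 - X ^ 4) : ℂ[X][X]) with hr
      have hrdeg : r.natDegree < 2 := by
        have := natDegree_modByMonic_lt p hmonic (by
          intro h1
          have := congrArg natDegree h1
          rw [natDegree_X_pow_sub_C, natDegree_one] at this
          omega)
        rwa [natDegree_X_pow_sub_C] at this
      have hr0 : toCurveField r = 0 := by
        have h' := congrArg toCurveField (modByMonic_add_div p (X ^ 2 - C (1 - X ^ 4)))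
        rw [map_add, map_mul, ← neg_sub (C (1 - X ^ 4) : ℂ[X][X]), map_neg, hc, h] at h'
        rwa [neg_zero, zero_mul, add_zero, neg_sub, ← hr] at h'
      rw [eq_X_add_C_of_natDegree_le_one (by omega : r.natDegree ≤ 1), map_add, map_mul,
        toCurveField_C, toCurveField_C, toCurveField_X] at hr0
      have h0 := congrArg QuadraticAlgebra.re hr0
      have h1 := congrArg QuadraticAlgebra.im hr0
      simp at h0 h1
      rw [eq_X_add_C_of_natDegree_le_one (by omega : r.natDegree ≤ 1), h0, h1]
      simp
    obtain ⟨s, rfl⟩ := hdvd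
    exact ⟨-s, by ring⟩
  · rintro ⟨s, rfl⟩
    rw [map_mul, hc, zero_mul]

/-- The function `(z - q) / (z - I * x ^ 2)` is not a norm for the cubic extension defined by
`y ^ 3 = 1 - x ^ 4 - z ^ 2`. -/
theorem eq_zero_of_norm_eq {I α β γ x₀ : ℂ} (hI : I ^ 2 = -1) (hβ : β ≠ 0)
    {q : ℂ[X]} (hq : q = C I * X ^ 2 + C β * X + C γ)
    (hqm : 1 - X ^ 4 - q ^ 2 = (C α * (X - C x₀)) ^ 3) (D P₀ P₁ P₂ : ℂ[X][X])
    (h : (X - C q) * D ^ 3 = (X - C (C I * X ^ 2)) *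
      (P₀ ^ 3 + (C (1 - X ^ 4) - X ^ 2) * P₁ ^ 3 + (C (1 - X ^ 4) - X ^ 2) ^ 2 * P₂ ^ 3
        - 3 * (C (1 - X ^ 4) - X ^ 2) * P₀ * P₁ * P₂)) : D = 0 := by
  set c : ℂ[X][X] := C (1 - X ^ 4) - X ^ 2 with hc
  have hcdeg : c.natDegree = 2 := by
    rw [hc, ← neg_sub, natDegree_neg, natDegree_X_pow_sub_C]
  have hc0 : c ≠ 0 := by
    intro h0
    rw [h0, natDegree_zero] at hcdeg
    omega
  have hker : ∀ p, toCurveField p = 0 ↔ c ∣ p := toCurveField_eq_zero_iff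
  have hφc : toCurveField c = 0 := (hker c).2 dvd_rfl
  have hunit : toCurveField (X - C (C I * X ^ 2)) * toCurveField (X + C (C I * X ^ 2)) = 1 := by
    have hcI : (C (C I) : ℂ[X][X]) ^ 2 = -1 := by rw [← C_pow, ← C_pow, hI]; simp
    have : (X - C (C I * X ^ 2) : ℂ[X][X]) * (X + C (C I * X ^ 2)) = 1 - c := by
      rw [hc]
      simp only [C_mul, C_sub, C_pow, C_1]
      linear_combination (-C X ^ 4) * hcI
    rw [← map_mul, this, map_sub, hφc, map_one, sub_zero]
  have hunit0 : toCurveField (X - C (C I * X ^ 2)) ≠ 0 := left_ne_zero_of_mul_eq_one hunit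
  have hcube : ∀ p : ℂ[X][X],
      toCurveField (X - C (C I * X ^ 2)) * toCurveField p ^ 3 = 0 → c ∣ p := by
    intro p hp
    rw [← hker]
    exact pow_eq_zero_iff (by norm_num) |>.1 ((mul_eq_zero.1 hp).resolve_left hunit0)
  by_contra hD
  induction hn : D.natDegree using Nat.strong_induction_on generalizing D P₀ P₁ P₂ with
  | _ n ih =>
  have hφ : toCurveField (X - C q) * toCurveField D ^ 3
      = toCurveField (X - C (C I * X ^ 2)) * toCurveField P₀ ^ 3 := by
    have := congrArg toCurveField h
    simp only [map_mul, map_add, map_sub, map_pow, hφc] at this ⊢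
    rw [this]; ring
  by_cases hφD : toCurveField D = 0
  · have hP₀ : c ∣ P₀ := hcube P₀ (by rw [← hφ, hφD]; simp)
    obtain ⟨D, rfl⟩ := (hker D).1 hφD
    obtain ⟨P₀, rfl⟩ := hP₀
    have hD' : D ≠ 0 := right_ne_zero_of_mul hD
    have hP₁ : c ∣ P₁ := by
      apply hcube P₁
      have h' : (X - C (C I * X ^ 2)) * P₁ ^ 3 = c * ((X - C q) * c * D ^ 3 -
          (X - C (C I * X ^ 2)) * (c * P₀ ^ 3 + P₂ ^ 3 - 3 * P₀ * P₁ * P₂)) := by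
        apply mul_left_cancel₀ hc0
        linear_combination -h
      rw [← map_pow, ← map_mul, h', map_mul, hφc, zero_mul]
    obtain ⟨P₁, rfl⟩ := hP₁
    have hP₂ : c ∣ P₂ := by
      apply hcube P₂
      have h' : (X - C (C I * X ^ 2)) * P₂ ^ 3 = c * ((X - C q) * D ^ 3 -
          (X - C (C I * X ^ 2)) * (P₀ ^ 3 + c * P₁ ^ 3 - 3 * P₀ * P₁ * P₂)) := by
        apply mul_left_cancel₀ (pow_ne_zero 2 hc0)
        linear_combination -h
      rw [← map_pow, ← map_mul, h', map_mul, hφc, zero_mul]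
    obtain ⟨P₂, rfl⟩ := hP₂
    refine ih D.natDegree ?_ D P₀ P₁ P₂ ?_ hD' rfl
    · rw [← hn, natDegree_mul hc0 hD', hcdeg]; omega
    · apply mul_left_cancel₀ (pow_ne_zero 3 hc0)
      linear_combination h
  · obtain ⟨u, hu⟩ : ∃ u : CurveField, u * toCurveField D = toCurveField P₀ :=
      ⟨toCurveField P₀ / toCurveField D, div_mul_cancel₀ _ hφD⟩
    have hu3 : u ^ 3 = toCurveField (X - C q) * toCurveField (X + C (C I * X ^ 2)) := by
      rw [← hu, mul_pow, ← mul_assoc] at hφ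
      have := mul_right_cancel₀ (pow_ne_zero 3 hφD) hφ
      rw [this]
      linear_combination -u ^ 3 * hunit
    rw [map_sub, map_add, toCurveField_X, toCurveField_C, toCurveField_C] at hu3
    have hre := congrArg QuadraticAlgebra.re hu3
    have him := congrArg QuadraticAlgebra.im hu3
    simp only [pow_succ, pow_zero, one_mul, QuadraticAlgebra.re_mul, QuadraticAlgebra.im_mul,
      QuadraticAlgebra.re_sub, QuadraticAlgebra.im_sub, QuadraticAlgebra.re_add,
      QuadraticAlgebra.im_add, QuadraticAlgebra.omega_re, QuadraticAlgebra.omega_im,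
      QuadraticAlgebra.algebraMap_re, QuadraticAlgebra.algebraMap_im] at hre him
    have hcI : (C I : ℂ[X]) ^ 2 = -1 := by rw [← C_pow, hI]; simp
    refine false_of_cube_on_curve (K := FractionRing ℂ[X]) (A := 1 - X ^ 4 - q * (C I * X ^ 2))
      (ℓ := C I * X ^ 2 - q) (m := C α * (X - C x₀)) ?_ ?_ ?_ ?_ u.re u.im ?_ ?_
    · have : (1 - X ^ 4 - q * (C I * X ^ 2) : ℂ[X]) =
          1 - C (β * I) * X ^ 3 - C (γ * I) * X ^ 2 := by
        rw [hq, C_mul, C_mul]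
        linear_combination (-X ^ 4) * hcI
      rw [this]
      compute_degree
    · compute_degree
    · rw [hq]
      intro h0
      have := congrArg (fun p => coeff p 1) h0
      simp [coeff_C] at this
      exact hβ this
    · rw [← hqm]
      linear_combination (X ^ 4 * (q ^ 2 - 1 + X ^ 4)) * hcI
    · simp only [map_sub, map_mul, map_pow, oneSubQuartic] at hre ⊢
      linear_combination hre
    · simp only [map_sub, map_mul, map_pow, oneSubQuartic] at him ⊢
      linear_combination him

end Descent

end Polynomial

section FieldGenerators

theorem adjoin_variables_eq_top : IntermediateField.adjoin ℂ {Vx, Vy, Vz} = ⊤ := by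
  rw [eq_top_iff]
  rintro a -
  have key : ∀ p : MvPolynomial (Fin 3) ℂ, algebraMap _ Fxyz p ∈
      IntermediateField.adjoin ℂ {Vx, Vy, Vz} := by
    intro p
    induction p using MvPolynomial.induction_on with
    | C a => exact IntermediateField.algebraMap_mem _ a
    | add p q hp hq => rw [map_add]; exact add_mem hp hq
    | mul_X p i hp =>
      rw [map_mul]
      refine mul_mem hp (IntermediateField.subset_adjoin _ _ ?_)
      fin_cases i <;> simp [Vx, Vy, Vz]
  obtain ⟨p, q, -, rfl⟩ := IsFractionRing.div_surjective (A := MvPolynomial (Fin 3) ℂ) a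
  exact div_mem (key p) (key q)

theorem trdeg_Fxyz : Algebra.trdeg ℂ Fxyz = 3 := by
  have : Algebra.IsAlgebraic (MvPolynomial (Fin 3) ℂ) Fxyz :=
    IsLocalization.isAlgebraic _ (nonZeroDivisors _)
  have h := (IsTranscendenceBasis.mvPolynomial (Fin 3) ℂ).algebraMap_comp (A := Fxyz)
  rw [← h.cardinalMk_eq_trdeg]
  simp

theorem adjoin_simple_eq_top_of_adjoin_insert {K L : Type*} [Field K] [Field L] [Algebra K L]
    {S : Set L} {y : L} (h : IntermediateField.adjoin K (insert y S) = ⊤) :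
    IntermediateField.adjoin (IntermediateField.adjoin K S) {y} = ⊤ := by
  rw [← IntermediateField.restrictScalars_eq_top_iff (K := K),
    IntermediateField.adjoin_adjoin_left, Set.union_singleton, h]

theorem isIntegral_of_pow_mem {K L : Type*} [Field K] [Field L] [Algebra K L]
    {k : IntermediateField K L} {y : L} {n : ℕ} (hn : 0 < n) (hy : y ^ n ∈ k) : IsIntegral k y :=
  IsIntegral.of_pow hn (isIntegral_algebraMap (x := (⟨y ^ n, hy⟩ : k)))

open scoped IntermediateField.algebraAdjoinAdjoin in
theorem algebraicIndependent_of_adjoin_insert {x : Fin 3 → Fxyz} {y : Fxyz} {n : ℕ} (hn : 0 < n)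
    (hy : y ^ n ∈ IntermediateField.adjoin ℂ (Set.range x))
    (h : IntermediateField.adjoin ℂ (insert y (Set.range x)) = ⊤) : AlgebraicIndependent ℂ x := by
  have h1 : Algebra.IsAlgebraic (IntermediateField.adjoin ℂ (Set.range x)) Fxyz := by
    have := IntermediateField.isAlgebraic_adjoin_simple (isIntegral_of_pow_mem hn hy)
    rw [adjoin_simple_eq_top_of_adjoin_insert h] at this
    exact IntermediateField.topEquiv.isAlgebraic
  have h2 : Algebra.IsAlgebraic (Algebra.adjoin ℂ (Set.range x)) Fxyz :=
    (IsFractionRing.comap_isAlgebraic_iff (K := IntermediateField.adjoin ℂ (Set.range x))).2 h1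
  refine (Algebra.IsAlgebraic.isTranscendenceBasis_of_le_trdeg_of_finite ℂ x ?_).1
  simp [trdeg_Fxyz]

/-- A cubic radical extension of a rational function field, with a common denominator. -/
theorem exists_repr_of_adjoin_cube_root {L : Type*} [Field L] [Algebra ℂ L] {x : Fin 3 → L} {Y : L}
    (hY : Y ^ 3 ∈ IntermediateField.adjoin ℂ (Set.range x))
    (h : IntermediateField.adjoin ℂ (insert Y (Set.range x)) = ⊤) (G : L) :
    ∃ D P₀ P₁ P₂ : MvPolynomial (Fin 3) ℂ, aeval x D ≠ 0 ∧
      G * aeval x D = aeval x P₀ + aeval x P₁ * Y + aeval x P₂ * Y ^ 2 := by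
  set k := IntermediateField.adjoin ℂ (Set.range x) with hk
  have hint : IsIntegral k Y := isIntegral_of_pow_mem (by norm_num) hY
  have hG : G ∈ (IntermediateField.adjoin k {Y}).toSubalgebra := by
    rw [adjoin_simple_eq_top_of_adjoin_insert h]; trivial
  rw [IntermediateField.adjoin_simple_toSubalgebra_of_isAlgebraic hint.isAlgebraic,
    Algebra.adjoin_singleton_eq_range_aeval] at hG
  obtain ⟨p, rfl⟩ := hG
  have hmonic : (Polynomial.X ^ 3 - Polynomial.C (⟨Y ^ 3, hY⟩ : k)).Monic :=
    Polynomial.monic_X_pow_sub_C _ three_ne_zero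
  set f := Polynomial.X ^ 3 - Polynomial.C (⟨Y ^ 3, hY⟩ : k) with hf
  have hf0 : Polynomial.aeval Y f = 0 := by
    rw [hf, map_sub, map_pow, Polynomial.aeval_X, Polynomial.aeval_C]
    exact sub_self _
  set r := p %ₘ f with hr
  have hpr : Polynomial.aeval Y p = Polynomial.aeval Y r :=
    (Polynomial.aeval_modByMonic_eq_self_of_root hf0).symm
  have hdeg : r.natDegree < 3 := by
    have := Polynomial.natDegree_modByMonic_lt p hmonic (by
      intro h1
      have := congrArg Polynomial.natDegree h1
      rw [hf, Polynomial.natDegree_X_pow_sub_C, Polynomial.natDegree_one] at this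
      omega)
    rwa [hf, Polynomial.natDegree_X_pow_sub_C] at this
  have hcoeff : ∀ a : k, ∃ u v : MvPolynomial (Fin 3) ℂ, aeval x v ≠ 0 ∧
      (a : L) * aeval x v = aeval x u := by
    intro a
    obtain ⟨u, v, huv⟩ := (IntermediateField.mem_adjoin_range_iff _ _ _).1 a.2
    by_cases hv : aeval x v = 0
    · exact ⟨0, 1, by simp, by rw [huv, hv]; simp⟩
    · exact ⟨u, v, hv, by rw [huv, div_mul_cancel₀ _ hv]⟩
  obtain ⟨u₀, v₀, hv₀, h₀⟩ := hcoeff (r.coeff 0)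
  obtain ⟨u₁, v₁, hv₁, h₁⟩ := hcoeff (r.coeff 1)
  obtain ⟨u₂, v₂, hv₂, h₂⟩ := hcoeff (r.coeff 2)
  refine ⟨v₀ * v₁ * v₂, u₀ * v₁ * v₂, v₀ * u₁ * v₂, v₀ * v₁ * u₂, ?_, ?_⟩
  · simp only [map_mul]
    exact mul_ne_zero (mul_ne_zero hv₀ hv₁) hv₂
  · change Polynomial.aeval Y p * _ = _
    rw [hpr, Polynomial.aeval_eq_sum_range' hdeg]
    simp only [Finset.sum_range_succ, Finset.sum_range_zero, map_mul, Algebra.smul_def,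
      IntermediateField.algebraMap_apply, ← h₀, ← h₁, ← h₂]
    ring

end FieldGenerators

section CubicTwist

theorem isUnit_mvPolynomial_complex_eq_C {u : MvPolynomial (Fin 3) ℂ} (hu : IsUnit u) :
    ∃ c : ℂ, c ≠ 0 ∧ u = C c := by
  obtain ⟨c, hc, rfl⟩ := MvPolynomial.isUnit_iff_eq_C_of_isReduced.1 hu
  exact ⟨c, hc.ne_zero, rfl⟩

/-- The polynomial identity expressing that `(z - q) / (z - I * x ^ 2)` is a norm fails. -/
theorem not_norm_mvPolynomial {I α β γ x₀ : ℂ} (hI : I ^ 2 = -1) (hβ : β ≠ 0)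
    (e₃ : -2 * I * β = α ^ 3) (e₂ : β ^ 2 + 2 * I * γ = 3 * α ^ 3 * x₀)
    (e₁ : -2 * β * γ = 3 * α ^ 3 * x₀ ^ 2) (e₀ : 1 - γ ^ 2 = -α ^ 3 * x₀ ^ 3)
    {D P₀ P₁ P₂ c : MvPolynomial (Fin 3) ℂ} (hc : c = 1 - X 0 ^ 4 - X 1 ^ 2) (hD : D ≠ 0) :
    (X 1 - (C I * X 0 ^ 2 + C β * X 0 + C γ)) * D ^ 3 ≠ (X 1 - C I * X 0 ^ 2) *
      (P₀ ^ 3 + c * P₁ ^ 3 + c ^ 2 * P₂ ^ 3 - 3 * c * P₀ * P₁ * P₂) := by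
  intro h
  obtain ⟨s, hs⟩ : ∃ s, eval s D ≠ 0 := by
    by_contra! h0
    exact hD (MvPolynomial.funext fun s => by rw [h0 s, map_zero])
  let f : MvPolynomial (Fin 3) ℂ →ₐ[ℂ] Polynomial (Polynomial ℂ) :=
    aeval ![Polynomial.C Polynomial.X, Polynomial.X, Polynomial.C (Polynomial.C (s 2))]
  have hfD : f D ≠ 0 := by
    intro h0
    apply hs
    have hcomp : eval s = ((Polynomial.evalRingHom (s 0)).comp
        (Polynomial.evalRingHom (Polynomial.C (s 1)))).comp f.toRingHom := by
      ext i
      · simp [f]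
      · fin_cases i <;> simp [f]
    rw [hcomp, RingHom.comp_apply]
    exact (congrArg _ h0).trans (map_zero _)
  have hfC : ∀ a : ℂ, f (C a) = Polynomial.C (Polynomial.C a) := fun a => f.commutes a
  have hf0 : f (X 0) = Polynomial.C Polynomial.X := by simp [f]
  have hf1 : f (X 1) = Polynomial.X := by simp [f]
  refine hfD (Polynomial.eq_zero_of_norm_eq (α := α) (γ := γ) (x₀ := x₀) hI hβ rfl ?_ _
    (f P₀) (f P₁) (f P₂) ?_)
  · have hI' := congrArg Polynomial.C hI
    have e₃' := congrArg Polynomial.C e₃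
    have e₂' := congrArg Polynomial.C e₂
    have e₁' := congrArg Polynomial.C e₁
    have e₀' := congrArg Polynomial.C e₀
    simp only [map_neg, map_mul, map_add, map_sub, map_pow, map_one, map_ofNat] at *
    linear_combination Polynomial.X ^ 3 * e₃' - Polynomial.X ^ 2 * e₂' + Polynomial.X * e₁' + e₀'
      - Polynomial.X ^ 4 * hI'
  · have := congrArg f h
    rw [hc] at this
    simpa only [map_mul, map_add, map_sub, map_pow, map_one, map_ofNat, hfC, hf0, hf1] using this

theorem norm_eq_of_root {R : Type*} [CommRing R] {ω : R} (hω : 1 + ω + ω ^ 2 = 0) (a b c y : R) :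
    (a + b * y + c * y ^ 2) * (a + b * (ω * y) + c * (ω * y) ^ 2) *
      (a + b * (ω * (ω * y)) + c * (ω * (ω * y)) ^ 2) =
      a ^ 3 + y ^ 3 * b ^ 3 + (y ^ 3) ^ 2 * c ^ 3 - 3 * y ^ 3 * a * b * c := by
  linear_combination (a + b * y + c * y ^ 2) * (a * b * y + a * c * y ^ 2 * (ω ^ 2 - ω + 1) +
    b ^ 2 * y ^ 2 * (ω - 1) + b * c * y ^ 3 * (ω ^ 3 - ω + 1) +
    c ^ 2 * y ^ 4 * (ω ^ 3 + 1) * (ω - 1)) * hω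

theorem false_of_cubic_twist {ω : ℂ} (hω : IsPrimitiveRoot ω 3)
    (σ : MvPolynomial (Fin 3) ℂ ≃+* MvPolynomial (Fin 3) ℂ) (hσ : ∀ b, σ (σ (σ b)) = b)
    (τ : Fxyz ≃ₐ[ℂ] Fxyz) (hτ : ∀ b, τ (algebraMap _ Fxyz b) = algebraMap _ Fxyz (σ b))
    {x y z w : Fxyz} (hxyz : x ^ 4 + y ^ 3 + z ^ 2 = 1) (hx : τ x = x)
    (hy : τ y = algebraMap ℂ Fxyz ω * y) (hz : τ z = z) (hw : τ w = w)
    (hgen : IntermediateField.adjoin ℂ (insert y (Set.range ![x, z, w])) = ⊤) : False := by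
  obtain ⟨I, α, β, γ, x₀, hI, hα, hβ, hx₀, e₃, e₂, e₁, e₀⟩ := exists_tangent_quadratic
  have hy3 : y ^ 3 ∈ IntermediateField.adjoin ℂ (Set.range ![x, z, w]) := by
    have hmem : ∀ i, ![x, z, w] i ∈ IntermediateField.adjoin ℂ (Set.range ![x, z, w]) :=
      fun i => IntermediateField.subset_adjoin _ _ ⟨i, rfl⟩
    rw [show y ^ 3 = 1 - x ^ 4 - z ^ 2 by linear_combination hxyz]
    exact sub_mem (sub_mem (one_mem _) (pow_mem (hmem 0) 4)) (pow_mem (hmem 1) 2)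
  have hind := algebraicIndependent_of_adjoin_insert (by norm_num) hy3 hgen
  have hinj : Function.Injective (aeval ![x, z, w] : MvPolynomial (Fin 3) ℂ →ₐ[ℂ] Fxyz) := hind
  set ψ : MvPolynomial (Fin 3) ℂ →ₐ[ℂ] Fxyz := aeval ![x, z, w] with hψ
  have hψC : ∀ a : ℂ, ψ (C a) = algebraMap ℂ Fxyz a := fun a => ψ.commutes a
  have hψ0 : ψ (X 0) = x := by simp [hψ]
  have hψ1 : ψ (X 1) = z := by simp [hψ]
  have hψ2 : ψ (X 2) = w := by simp [hψ]
  have hτψ : ∀ p, τ (ψ p) = ψ p := by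
    intro p
    have : (τ : Fxyz →ₐ[ℂ] Fxyz).comp ψ = ψ := by
      ext i
      fin_cases i
      · simpa [hψ0] using hx
      · simpa [hψ1] using hz
      · simpa [hψ2] using hw
    exact DFunLike.congr_fun this p
  obtain ⟨Q, hQ⟩ : ∃ Q : MvPolynomial (Fin 3) ℂ, Q = X 1 - (C I * X 0 ^ 2 + C β * X 0 + C γ) :=
    ⟨_, rfl⟩
  obtain ⟨Q', hQ'⟩ : ∃ Q' : MvPolynomial (Fin 3) ℂ, Q' = X 1 - C I * X 0 ^ 2 := ⟨_, rfl⟩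
  have hQ0 : ψ Q ≠ 0 := by
    rw [map_ne_zero_iff ψ hinj]
    intro h0
    have := congrArg (eval ![0, γ + 1, 0]) (hQ.symm.trans h0)
    simp at this
  have hQ'0 : ψ Q' ≠ 0 := by
    rw [map_ne_zero_iff ψ hinj]
    intro h0
    have := congrArg (eval ![0, 1, 0]) (hQ'.symm.trans h0)
    simp at this
  obtain ⟨u, G, hG⟩ := exists_eq_unit_mul_norm_of_valuation σ hσ τ.toRingEquiv hτ (ψ Q / ψ Q')
    (div_ne_zero hQ0 hQ'0) (by change τ _ = _; rw [map_div₀, hτψ, hτψ]) (by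
      intro v hvτ hvu
      replace hvτ : ∀ a, v (τ a) = v a := hvτ
      have hvC : ∀ c : ℂ, c ≠ 0 → v (algebraMap ℂ Fxyz c) = 1 := fun c hc =>
        hvu (Units.map (algebraMap ℂ (MvPolynomial (Fin 3) ℂ)).toMonoidHom (Units.mk0 c hc))
      have hinv : ∀ n, τ n = n → v (n - algebraMap ℂ Fxyz ω * y) = v (n - y) ∧
          v (n - algebraMap ℂ Fxyz (ω ^ 2) * y) = v (n - y) := by
        intro n hn
        have h1 : τ (n - y) = n - algebraMap ℂ Fxyz ω * y := by rw [map_sub, hn, hy]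
        have h2 : τ (n - algebraMap ℂ Fxyz ω * y) = n - algebraMap ℂ Fxyz (ω ^ 2) * y := by
          rw [map_sub, hn, map_mul, hy, τ.commutes, map_pow]; ring
        rw [← h2, hvτ, ← h1, hvτ]
        exact ⟨rfl, rfl⟩
      have := exists_cube_root_valuation_div v hvC hω hI hα hx₀ (X := x) (Y := y) (Z := z) hxyz
        rfl rfl rfl (m := algebraMap ℂ Fxyz α * (x - algebraMap ℂ Fxyz x₀)) ?_ ?_
      · simpa only [hQ, hQ', map_sub, map_add, map_mul, map_pow, hψC, hψ0, hψ1] using this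
      · have hI' := congrArg (algebraMap ℂ Fxyz) hI
        have e₃' := congrArg (algebraMap ℂ Fxyz) e₃
        have e₂' := congrArg (algebraMap ℂ Fxyz) e₂
        have e₁' := congrArg (algebraMap ℂ Fxyz) e₁
        have e₀' := congrArg (algebraMap ℂ Fxyz) e₀
        simp only [map_neg, map_mul, map_add, map_sub, map_pow, map_one, map_ofNat]
          at hI' e₃' e₂' e₁' e₀'
        linear_combination x ^ 3 * e₃' - x ^ 2 * e₂' + x * e₁' + e₀' - x ^ 4 * hI'
      · rintro n (rfl | rfl)
        · exact hinv _ (by rw [map_mul, map_sub, τ.commutes, τ.commutes, hx])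
        · exact hinv _ (map_one τ))
  obtain ⟨c, hc0, hc⟩ := isUnit_mvPolynomial_complex_eq_C u.isUnit
  obtain ⟨d, hd⟩ := IsAlgClosed.exists_pow_nat_eq c (n := 3) (by norm_num)
  obtain ⟨D, P₀, P₁, P₂, hD, hrep⟩ := exists_repr_of_adjoin_cube_root hy3 hgen
    (algebraMap ℂ Fxyz d * G)
  rw [← hψ] at hD hrep
  have hD0 : D ≠ 0 := by rintro rfl; exact hD (map_zero ψ)
  refine not_norm_mvPolynomial hI hβ e₃ e₂ e₁ e₀ (P₀ := P₀) (P₁ := P₁) (P₂ := P₂) rfl hD0 ?_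
  rw [← hQ, ← hQ']
  apply hinj
  have hrep₁ := congrArg τ hrep
  have hrep₂ := congrArg τ hrep₁
  simp only [map_mul, map_add, map_pow, hτψ, hy, τ.commutes] at hrep₁ hrep₂
  have hG' : ψ Q = algebraMap ℂ Fxyz d ^ 3 * (G * τ G * τ (τ G)) * ψ Q' := by
    rw [div_eq_iff hQ'0] at hG
    rw [hG, hc, ← map_pow, hd]
    rfl
  have hsum : 1 + algebraMap ℂ Fxyz ω + algebraMap ℂ Fxyz ω ^ 2 = 0 := by
    have := hω.geom_sum_eq_zero (by norm_num)
    simpa [Finset.sum_range_succ] using congrArg (algebraMap ℂ Fxyz) this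
  have hprod : algebraMap ℂ Fxyz d ^ 3 * (G * τ G * τ (τ G)) * ψ D ^ 3 =
      ψ P₀ ^ 3 + y ^ 3 * ψ P₁ ^ 3 + (y ^ 3) ^ 2 * ψ P₂ ^ 3 - 3 * y ^ 3 * ψ P₀ * ψ P₁ * ψ P₂ := by
    rw [show algebraMap ℂ Fxyz d ^ 3 * (G * τ G * τ (τ G)) * ψ D ^ 3 =
      (algebraMap ℂ Fxyz d * G * ψ D) * (algebraMap ℂ Fxyz d * τ G * ψ D) *
        (algebraMap ℂ Fxyz d * τ (τ G) * ψ D) by ring, hrep, hrep₁, hrep₂]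
    exact norm_eq_of_root hsum _ _ _ _
  have hy3' : y ^ 3 = 1 - x ^ 4 - z ^ 2 := by linear_combination hxyz
  rw [hy3'] at hprod
  simp only [map_mul, map_add, map_sub, map_pow, map_one, map_ofNat, hψ0, hψ1]
  rw [hG']
  linear_combination ψ Q' * hprod

end CubicTwist

section Scaling

theorem C_mul_C_mul_X_zero_of_pow_three {ω : ℂ} (hω : ω ^ 3 = 1) :
    (C ω ^ 2 * (C ω * X 0) : MvPolynomial (Fin 3) ℂ) = X 0 := by
  rw [← mul_assoc, ← pow_succ, ← C_pow, hω, C_1, one_mul]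

/-- The automorphism of the polynomial ring multiplying the first variable by `ω`. -/
def scaleFirst {ω : ℂ} (hω : ω ^ 3 = 1) :
    MvPolynomial (Fin 3) ℂ ≃ₐ[ℂ] MvPolynomial (Fin 3) ℂ :=
  AlgEquiv.ofAlgHom (aeval ![C ω * X 0, X 1, X 2]) (aeval ![C (ω ^ 2) * X 0, X 1, X 2])
    (by
      ext i : 1
      fin_cases i
      · simpa using C_mul_C_mul_X_zero_of_pow_three hω
      · simp
      · simp)
    (by
      ext i : 1
      fin_cases i
      · simpa [mul_left_comm] using C_mul_C_mul_X_zero_of_pow_three hω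
      · simp
      · simp)

theorem scaleFirst_apply {ω : ℂ} (hω : ω ^ 3 = 1) (p : MvPolynomial (Fin 3) ℂ) :
    scaleFirst hω p = aeval ![C ω * X 0, X 1, X 2] p := rfl

theorem scaleFirst_scaleFirst_scaleFirst {ω : ℂ} (hω : ω ^ 3 = 1) (p : MvPolynomial (Fin 3) ℂ) :
    scaleFirst hω (scaleFirst hω (scaleFirst hω p)) = p := by
  have : ((scaleFirst hω : _ →ₐ[ℂ] MvPolynomial (Fin 3) ℂ).comp
      (scaleFirst hω : _ →ₐ[ℂ] MvPolynomial (Fin 3) ℂ)).comp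
      (scaleFirst hω : _ →ₐ[ℂ] MvPolynomial (Fin 3) ℂ) = AlgHom.id ℂ _ := by
    ext i : 1
    fin_cases i
    · simp only [AlgHom.comp_apply, AlgEquiv.coe_toAlgHom, scaleFirst_apply]
      simpa [sq, mul_assoc] using C_mul_C_mul_X_zero_of_pow_three hω
    · simp [scaleFirst_apply]
    · simp [scaleFirst_apply]
  exact DFunLike.congr_fun this p

/-- The automorphism of `ℂ(x, y, z)` multiplying the first variable by `ω`. -/
def fieldScaleFirst {ω : ℂ} (hω : ω ^ 3 = 1) : Fxyz ≃ₐ[ℂ] Fxyz :=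
  IsFractionRing.fieldEquivOfAlgEquiv ℂ Fxyz Fxyz (scaleFirst hω)

theorem fieldScaleFirst_algebraMap {ω : ℂ} (hω : ω ^ 3 = 1) (p : MvPolynomial (Fin 3) ℂ) :
    fieldScaleFirst hω (algebraMap _ Fxyz p) = algebraMap _ Fxyz (scaleFirst hω p) :=
  IsFractionRing.fieldEquivOfAlgEquiv_algebraMap ..

theorem fieldScaleFirst_Vx {ω : ℂ} (hω : ω ^ 3 = 1) :
    fieldScaleFirst hω Vx = algebraMap ℂ Fxyz ω * Vx := by
  rw [Vx, fieldScaleFirst_algebraMap, scaleFirst_apply, aeval_X]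
  simp only [Matrix.cons_val_zero, map_mul]
  rfl

theorem fieldScaleFirst_Vy {ω : ℂ} (hω : ω ^ 3 = 1) : fieldScaleFirst hω Vy = Vy := by
  rw [Vy, fieldScaleFirst_algebraMap, scaleFirst_apply, aeval_X]
  simp

theorem fieldScaleFirst_Vz {ω : ℂ} (hω : ω ^ 3 = 1) : fieldScaleFirst hω Vz = Vz := by
  rw [Vz, fieldScaleFirst_algebraMap, scaleFirst_apply, aeval_X]
  simp

/-- Adjoining a twelfth root of the first generator of a rational function field. -/
theorem exists_algHom_of_adjoin_eq_top {t g h : Fxyz}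
    (htop : IntermediateField.adjoin ℂ {t, g, h} = ⊤) :
    ∃ κ : Fxyz →ₐ[ℂ] Fxyz, κ t = Vx ^ 12 ∧ κ g = Vy ∧ κ h = Vz := by
  have hrange : ∀ a b c : Fxyz, Set.range ![a, b, c] = {a, b, c} := fun a b c => by
    rw [Matrix.range_cons, Matrix.range_cons, Matrix.range_cons, Matrix.range_empty]
    rw [Set.union_empty, Set.insert_eq, Set.insert_eq]
  have hind : AlgebraicIndependent ℂ ![t, g, h] := by
    have htop' : IntermediateField.adjoin ℂ (Set.range ![t, g, h]) = ⊤ := by rw [hrange, htop]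
    refine algebraicIndependent_of_adjoin_insert (y := 1) (n := 1) one_pos ?_ ?_
    · simp
    · exact eq_top_iff.2 (htop'.ge.trans
        (IntermediateField.adjoin.mono _ _ _ (Set.subset_insert _ _)))
  have hind' : AlgebraicIndependent ℂ ![Vx ^ 12, Vy, Vz] := by
    refine algebraicIndependent_of_adjoin_insert (y := Vx) (n := 12) (by norm_num) ?_ ?_
    · exact IntermediateField.subset_adjoin _ _ ⟨0, rfl⟩
    · refine eq_top_iff.2 (adjoin_variables_eq_top.ge.trans
        (IntermediateField.adjoin.mono _ _ _ ?_))
      rw [hrange]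
      rintro a (rfl | rfl | rfl) <;> simp
  have hmem : ∀ a : Fxyz, a ∈ IntermediateField.adjoin ℂ (Set.range ![t, g, h]) := fun a => by
    rw [hrange, htop]; trivial
  let e : Fxyz →ₐ[ℂ] IntermediateField.adjoin ℂ (Set.range ![t, g, h]) :=
    (IntermediateField.inclusion (fun a _ => hmem a)).comp
      (IntermediateField.topEquiv (F := ℂ) (E := Fxyz)).symm.toAlgHom
  have he : ∀ i, hind.aevalEquivField.symm (e (![t, g, h] i)) =
      algebraMap (MvPolynomial (Fin 3) ℂ) Fxyz (X i) := by
    intro i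
    rw [AlgEquiv.symm_apply_eq]
    apply Subtype.ext
    rw [hind.aevalEquivField_algebraMap_apply_coe, aeval_X]
    rfl
  let κ : Fxyz →ₐ[ℂ] Fxyz :=
    ((IntermediateField.val _).comp hind'.aevalEquivField.toAlgHom).comp
      (hind.aevalEquivField.symm.toAlgHom.comp e)
  have hκ : ∀ i, κ (![t, g, h] i) = ![Vx ^ 12, Vy, Vz] i := by
    intro i
    change ((hind'.aevalEquivField (hind.aevalEquivField.symm (e (![t, g, h] i))) :
      IntermediateField.adjoin ℂ (Set.range ![Vx ^ 12, Vy, Vz])) : Fxyz) = _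
    rw [he, hind'.aevalEquivField_algebraMap_apply_coe, aeval_X]
  exact ⟨κ, hκ 0, hκ 1, hκ 2⟩

end Scaling

theorem e6_not_rational :
    ¬ ∃ g h : Fxyz,
      IntermediateField.adjoin ℂ {Vx ^ 4 + Vy ^ 3 + Vz ^ 2, g, h} =
        (⊤ : IntermediateField ℂ Fxyz) := by
  rintro ⟨g, h, htop⟩
  obtain ⟨κ, ht, hg, hh⟩ := exists_algHom_of_adjoin_eq_top htop
  obtain ⟨ω, hω⟩ : ∃ ω : ℂ, IsPrimitiveRoot ω 3 := ⟨_, Complex.isPrimitiveRoot_exp 3 three_ne_zero⟩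
  have hω3 := hω.pow_eq_one
  set τ := fieldScaleFirst hω3
  have hωL : algebraMap ℂ Fxyz ω ^ 3 = 1 := by rw [← map_pow, hω3, map_one]
  have hωL0 : algebraMap ℂ Fxyz ω ≠ 0 := by
    rw [map_ne_zero]
    exact hω.ne_zero three_ne_zero
  have hρ : Vx ≠ 0 := by simp [Vx]
  have hρτ : τ Vx = algebraMap ℂ Fxyz ω * Vx := fieldScaleFirst_Vx hω3
  have hρτ3 : τ (Vx ^ 3) = Vx ^ 3 := by rw [map_pow, hρτ, mul_pow, hωL, one_mul]
  have hκτ : ∀ a, τ (κ a) = κ a := by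
    intro a
    have ha : a ∈ IntermediateField.adjoin ℂ {Vx ^ 4 + Vy ^ 3 + Vz ^ 2, g, h} := by
      rw [htop]; trivial
    induction ha using IntermediateField.adjoin_induction with
    | mem b hb =>
      rcases hb with rfl | rfl | rfl
      · rw [ht, show Vx ^ 12 = (Vx ^ 3) ^ 4 by ring, map_pow, hρτ3]
      · rw [hg]; exact fieldScaleFirst_Vy hω3
      · rw [hh]; exact fieldScaleFirst_Vz hω3
    | algebraMap c => rw [κ.commutes, τ.commutes]
    | add b c _ _ hb hc => rw [map_add, map_add, hb, hc]
    | inv b _ hb => rw [map_inv₀, map_inv₀, hb]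
    | mul b c _ _ hb hc => rw [map_mul, map_mul, hb, hc]
  simp only [map_add, map_pow] at ht
  have hy0 : κ Vy ≠ 0 := by rw [map_ne_zero]; simp [Vy]
  refine false_of_cubic_twist hω.inv (scaleFirst hω3 : _ ≃+* _)
    (scaleFirst_scaleFirst_scaleFirst hω3) τ (fieldScaleFirst_algebraMap hω3)
    (x := κ Vx / Vx ^ 3) (y := κ Vy / Vx ^ 4) (z := κ Vz / Vx ^ 6) (w := κ Vy / Vx ^ 3)
    ?_ ?_ ?_ ?_ ?_ ?_
  · field_simp
    linear_combination ht
  · rw [map_div₀, hκτ, hρτ3]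
  · rw [map_div₀, hκτ, map_pow, hρτ, map_inv₀]
    field_simp
    linear_combination -hωL
  · rw [map_div₀, hκτ, show Vx ^ 6 = (Vx ^ 3) ^ 2 by ring, map_pow, hρτ3]
  · rw [map_div₀, hκτ, hρτ3]
  · set N := IntermediateField.adjoin ℂ (insert (κ Vy / Vx ^ 4)
      (Set.range ![κ Vx / Vx ^ 3, κ Vz / Vx ^ 6, κ Vy / Vx ^ 3])) with hN
    have hmem : ∀ i, ![κ Vx / Vx ^ 3, κ Vz / Vx ^ 6, κ Vy / Vx ^ 3] i ∈ N := fun i =>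
      IntermediateField.subset_adjoin _ _ (Set.mem_insert_of_mem _ ⟨i, rfl⟩)
    have hyN : κ Vy / Vx ^ 4 ∈ N := IntermediateField.subset_adjoin _ _ (Set.mem_insert _ _)
    have hxN : κ Vx / Vx ^ 3 ∈ N := hmem 0
    have hzN : κ Vz / Vx ^ 6 ∈ N := hmem 1
    have hwN : κ Vy / Vx ^ 3 ∈ N := hmem 2
    have hρN : Vx ∈ N := by
      have := div_mem hwN hyN
      rwa [show κ Vy / Vx ^ 3 / (κ Vy / Vx ^ 4) = Vx by field_simp] at this
    have hκN : ⊤ ≤ N.comap κ := by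
      rw [← adjoin_variables_eq_top, IntermediateField.adjoin_le_iff]
      rintro a (rfl | rfl | rfl)
      · have := mul_mem hxN (pow_mem hρN 3)
        rwa [div_mul_cancel₀ _ (pow_ne_zero _ hρ)] at this
      · have := mul_mem hyN (pow_mem hρN 4)
        rwa [div_mul_cancel₀ _ (pow_ne_zero _ hρ)] at this
      · have := mul_mem hzN (pow_mem hρN 6)
        rwa [div_mul_cancel₀ _ (pow_ne_zero _ hρ)] at this
    have hκmem : ∀ a, κ a ∈ N := fun a => hκN (x := a) trivial
    rw [eq_top_iff, ← adjoin_variables_eq_top, IntermediateField.adjoin_le_iff]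
    rintro a (rfl | rfl | rfl)
    · exact hρN
    · exact hg ▸ hκmem g
    · exact hh ▸ hκmem h

end
end
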